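/- Let f ∈ H²(𝔹). Then f is outer if and only if fᶜ is outer. -/

import Mathlib

open MeasureTheory Filter Topology
open scoped ENNReal Classical

noncomputable section

/-! ### Basic quaternionic notions -/

instance : MeasurableSpace (Quaternion ℝ) := borel _
instance : BorelSpace (Quaternion ℝ) := ⟨rfl⟩

/-- The 2-sphere `𝕊` of quaternionic imaginary units. -/
def USphere : Set (Quaternion ℝ) := {q | q ^ 2 = -1}

/-- The open quaternionic unit ball `𝔹`. -/
def QBall : Set (Quaternion ℝ) := {q | ‖q‖ < 1}

/-- The slice `L_I = ℝ + ℝI` through an imaginary unit `I`. -/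
def sliceSet (I : Quaternion ℝ) : Set (Quaternion ℝ) :=
  {q | ∃ x y : ℝ, q = (x : Quaternion ℝ) + y • I}

/-- The point `e^{tI} = cos t + (sin t) I` of the boundary circle `∂𝔹_I`. -/
def ptOn (I : Quaternion ℝ) (t : ℝ) : Quaternion ℝ :=
  ((Real.cos t : ℝ) : Quaternion ℝ) + Real.sin t • I

/-- Slice regularity on the unit ball: on every slice the restriction of `f` has partial
derivatives satisfying the Cauchy–Riemann equation `∂f/∂x + I ∂f/∂y = 0`. -/
def SliceRegular (f : Quaternion ℝ → Quaternion ℝ) : Prop :=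
  ∀ I ∈ USphere, ∀ x y : ℝ, ((x : Quaternion ℝ) + y • I) ∈ QBall →
    ∃ fx fy : Quaternion ℝ,
      HasDerivAt (fun s : ℝ => f ((s : Quaternion ℝ) + y • I)) fx x ∧
      HasDerivAt (fun t : ℝ => f ((x : Quaternion ℝ) + t • I)) fy y ∧
      fx + I * fy = 0

/-! ### The Hardy space `H²(𝔹)` via power series coefficients.
A slice regular function on `𝔹` is identified with its coefficient sequence
`a : ℕ → ℍ`, the function being `q ↦ ∑ qⁿ aₙ`. -/

/-- Membership in `H²(𝔹)`: square-summable coefficients. -/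
def MemH2 (a : ℕ → Quaternion ℝ) : Prop := Summable (fun n => ‖a n‖ ^ 2)

/-- Evaluation of the power series `q ↦ ∑ qⁿ aₙ`. -/
def evalS (a : ℕ → Quaternion ℝ) (q : Quaternion ℝ) : Quaternion ℝ := ∑' n, q ^ n * a n

/-- The `*`-product (slice product) on coefficient sequences. -/
def sProd (a b : ℕ → Quaternion ℝ) : ℕ → Quaternion ℝ :=
  fun n => ∑ k ∈ Finset.range (n + 1), a k * b (n - k)

/-- The regular conjugate `fᶜ`. -/
def conjS (a : ℕ → Quaternion ℝ) : ℕ → Quaternion ℝ := fun n => star (a n)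

/-- The symmetrization `fˢ = f * fᶜ`. -/
def symmS (a : ℕ → Quaternion ℝ) : ℕ → Quaternion ℝ := sProd a (conjS a)

/-- The squared `H²` norm `∑ ‖aₙ‖²`. -/
def h2normSq (a : ℕ → Quaternion ℝ) : ℝ := ∑' n, ‖a n‖ ^ 2

/-- The `H²` norm. -/
def h2norm (a : ℕ → Quaternion ℝ) : ℝ := Real.sqrt (h2normSq a)

/-- The (right) quaternionic inner product `⟨f,g⟩ = ∑ conj(bₙ) aₙ` of `H²(𝔹)`. -/
def h2inner (a b : ℕ → Quaternion ℝ) : Quaternion ℝ := ∑' n, star (b n) * a n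

/-- Squared `H²`-distance of two coefficient sequences (valued in `ℝ≥0∞`). -/
def h2distSq (a b : ℕ → Quaternion ℝ) : ℝ≥0∞ := ∑' n, (‖a n - b n‖₊ : ℝ≥0∞) ^ 2

/-- The boundary value function of `f ∈ H²(𝔹)`, given by the radial limit where it exists. -/
def bdval (a : ℕ → Quaternion ℝ) (q : Quaternion ℝ) : Quaternion ℝ :=
  if h : ∃ L, Tendsto (fun r : ℝ => evalS a ((r : Quaternion ℝ) * q)) (𝓝[<] (1 : ℝ)) (𝓝 L)
  then h.choose else 0

/-! ### The measure `Σ` on `∂𝔹` with `dΣ(e^{tI}) = dσ(I) dt`. -/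

/-- The normalized area measure `σ` on the sphere `𝕊` of imaginary units
(2-dimensional Hausdorff measure, normalized so that `σ(𝕊) = 1`). -/
def sphMeasure : Measure (Quaternion ℝ) := (μH[2] USphere)⁻¹ • (μH[2]).restrict USphere

/-- The measure `Σ` on `∂𝔹`, `dΣ(e^{tI}) = dσ(I) dt`, normalized so `Σ(∂𝔹) = 1`. -/
def SigmaBd : Measure (Quaternion ℝ) :=
  (ENNReal.ofReal (2 * Real.pi))⁻¹ •
    Measure.map (fun p : ℝ × Quaternion ℝ => ptOn p.2 p.1)
      ((volume.restrict (Set.Ico 0 (2 * Real.pi))).prod sphMeasure)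

/-! ### Inner, outer, cyclic -/

/-- `f ∈ H^∞(𝔹)`: a bounded function of `H²(𝔹)`. -/
def MemHinf (a : ℕ → Quaternion ℝ) : Prop :=
  MemH2 a ∧ ∃ C : ℝ, ∀ q ∈ QBall, ‖evalS a q‖ ≤ C

/-- The `H^∞` norm: the sup of `‖f‖` on the ball. -/
def hInfNorm (a : ℕ → Quaternion ℝ) : ℝ := sSup ((fun q => ‖evalS a q‖) '' QBall)

/-- `f` is inner: `f ∈ H^∞(𝔹)`, `‖f‖ ≤ 1` on `𝔹` and `‖f‖ = 1` `Σ`-a.e. on `∂𝔹`. -/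
def IsInnerQ (a : ℕ → Quaternion ℝ) : Prop :=
  MemH2 a ∧ (∀ q ∈ QBall, ‖evalS a q‖ ≤ 1) ∧ (∀ᵐ q ∂SigmaBd, ‖bdval a q‖ = 1)

/-- `g` is outer: whenever `f ∈ H²(𝔹)` has the same boundary modulus `Σ`-a.e.,
then `‖g‖ ≥ ‖f‖` throughout `𝔹`. -/
def IsOuterQ (g : ℕ → Quaternion ℝ) : Prop :=
  MemH2 g ∧ ∀ f, MemH2 f → (∀ᵐ q ∂SigmaBd, ‖bdval g q‖ = ‖bdval f q‖) →
    ∀ q ∈ QBall, ‖evalS f q‖ ≤ ‖evalS g q‖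

/-- Quaternionic polynomials (finitely supported coefficient sequences). -/
def IsPolyQ (p : ℕ → Quaternion ℝ) : Prop := ∃ N, ∀ n > N, p n = 0

/-- Quaternionic polynomials of degree at most `n` (the space `𝒫_n`). -/
def IsPolyDeg (p : ℕ → Quaternion ℝ) (n : ℕ) : Prop := ∀ m > n, p m = 0

/-- The coefficient sequence of the monomial `qᵏ`. -/
def qpow (k : ℕ) : ℕ → Quaternion ℝ := fun n => if n = k then 1 else 0

/-- The coefficient sequence of a constant function. -/
def constS (c : Quaternion ℝ) : ℕ → Quaternion ℝ := fun n => if n = 0 then c else 0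

/-- The coefficient sequence of the constant function `1`. -/
def oneS : ℕ → Quaternion ℝ := constS 1

/-- The invariant subspace `[g]`: the `H²`-closure of `{g * p : p polynomial}`,
i.e. of the right span of `{qⁿ * g : n ≥ 0}`. -/
def InvSub (g : ℕ → Quaternion ℝ) : Set (ℕ → Quaternion ℝ) :=
  {h | MemH2 h ∧ ∀ ε : ℝ≥0∞, 0 < ε → ∃ p, IsPolyQ p ∧ h2distSq (sProd g p) h < ε}

/-- `g` is cyclic: `[g] = H²(𝔹)`. -/
def IsCyclicQ (g : ℕ → Quaternion ℝ) : Prop :=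
  MemH2 g ∧ ∀ h, MemH2 h → h ∈ InvSub g

/-! ### Bilateral (slice `L²`) series, used for boundary products -/

/-- Bilateral coefficients of `f̃(q) = f(q̄)` on `∂𝔹`: `Σ_{n ≤ 0} qⁿ a_{-n}`. -/
def tildeZ (a : ℕ → Quaternion ℝ) : ℤ → Quaternion ℝ :=
  fun k => if k ≤ 0 then a (-k).toNat else 0

/-- Bilateral coefficients of `fᶜ` on `∂𝔹`. -/
def conjZ (a : ℕ → Quaternion ℝ) : ℤ → Quaternion ℝ :=
  fun k => if 0 ≤ k then star (a k.toNat) else 0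

/-- The `*`-product of two slice `L²` functions on the boundary, on coefficients. -/
def convZ (c b : ℤ → Quaternion ℝ) : ℤ → Quaternion ℝ := fun n => ∑' k : ℤ, c k * b (n - k)

/-- Evaluation of a bilateral series `q ↦ ∑_{n ∈ ℤ} qⁿ dₙ`. -/
def evalZ (d : ℤ → Quaternion ℝ) (q : Quaternion ℝ) : Quaternion ℝ := ∑' n : ℤ, q ^ n * d n

/-- The slice inner product `⟨qᵏ * f, f⟩_I = (1/2π)∫₀^{2π} conj(f(e^{θI})) (e^{θI})ᵏ f(e^{θI}) dθ`,
computed with boundary values; note `(qᵏ * f)(q) = qᵏ f(q)` pointwise. -/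
def sliceInnerPow (a : ℕ → Quaternion ℝ) (I : Quaternion ℝ) (k : ℕ) : Quaternion ℝ :=
  (2 * Real.pi)⁻¹ •
    ∫ t in Set.Ico 0 (2 * Real.pi), star (bdval a (ptOn I t)) * ((ptOn I t) ^ k * bdval a (ptOn I t))

/-! ### Complex Hardy space `H²(𝔻)` notions (for slice restrictions) -/

/-- Membership in the complex Hardy space `H²(𝔻)` via coefficients. -/
def CMemH2 (c : ℕ → ℂ) : Prop := Summable (fun n => ‖c n‖ ^ 2)

/-- Evaluation of a complex power series. -/
def cEval (c : ℕ → ℂ) (z : ℂ) : ℂ := ∑' n, z ^ n * c n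

/-- Cauchy product of complex coefficient sequences. -/
def cConv (c d : ℕ → ℂ) : ℕ → ℂ := fun n => ∑ k ∈ Finset.range (n + 1), c k * d (n - k)

/-- Squared `H²(𝔻)` distance. -/
def cDistSq (c d : ℕ → ℂ) : ℝ≥0∞ := ∑' n, (‖c n - d n‖₊ : ℝ≥0∞) ^ 2

/-- Radial boundary values of a complex `H²` function. -/
def cBdval (c : ℕ → ℂ) (z : ℂ) : ℂ :=
  if h : ∃ L, Tendsto (fun r : ℝ => cEval c ((r : ℂ) * z)) (𝓝[<] (1 : ℝ)) (𝓝 L)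
  then h.choose else 0

/-- Lebesgue measure on the unit circle `∂𝔻` (parametrized by `θ ∈ [0, 2π)`). -/
def circleM : Measure ℂ :=
  Measure.map (fun t : ℝ => Complex.exp (t * Complex.I)) (volume.restrict (Set.Ico 0 (2 * Real.pi)))

/-- Cyclicity in `H²(𝔻)`: polynomial multiples of `c` are dense. -/
def CIsCyclic (c : ℕ → ℂ) : Prop :=
  CMemH2 c ∧ ∀ h, CMemH2 h → ∀ ε : ℝ≥0∞, 0 < ε →
    ∃ p : ℕ → ℂ, (∃ N, ∀ n > N, p n = 0) ∧ cDistSq (cConv c p) h < ε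

/-- Outerness in `H²(𝔻)` (in the sense matching Definition 2.10 of the paper). -/
def CIsOuter (c : ℕ → ℂ) : Prop :=
  CMemH2 c ∧ ∀ h, CMemH2 h →
    (∀ᵐ z ∂circleM, ‖cBdval c z‖ = ‖cBdval h z‖) →
    ∀ z ∈ Metric.ball (0 : ℂ) 1, ‖cEval h z‖ ≤ ‖cEval c z‖

/-- Complex coordinates of a point of the slice `L_I`: if `p = x + yI` then
`sliceToC I p = x + iy`. -/
def sliceToC (I : Quaternion ℝ) (p : Quaternion ℝ) : ℂ := ⟨p.re, -(p * I).re⟩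

/-- The quaternion `i`. -/
def qI : Quaternion ℝ := ⟨0, 1, 0, 0⟩

/-- The embedding of `ℂ = L_i` into the quaternions. -/
def cToQ (z : ℂ) : Quaternion ℝ := (z.re : Quaternion ℝ) + z.im • qI

/-- The imaginary unit `I_ω` identified by `ω` (any imaginary unit if `ω` is real). -/
def Iu (ω : Quaternion ℝ) : Quaternion ℝ := if ω.im = 0 then qI else ‖ω.im‖⁻¹ • ω.im

/-! ### Optimal approximants -/

/-- `p` is an optimal approximant of degree `n` of `f^{-*}`: `p ∈ 𝒫_n` minimizes
`‖f * p - 1‖_{H²}` among all `p ∈ 𝒫_n`. -/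
def IsOptApprox (a : ℕ → Quaternion ℝ) (n : ℕ) (p : ℕ → Quaternion ℝ) : Prop :=
  IsPolyDeg p n ∧ ∀ r, IsPolyDeg r n → h2distSq (sProd a p) oneS ≤ h2distSq (sProd a r) oneS

end

namespace OuterProof

open ComplexConjugate

noncomputable section

instance factTwoPi : Fact (0 < 2 * Real.pi) := ⟨Real.two_pi_pos⟩

lemma hsc {ι E : Type*} [AddCommMonoid E] [TopologicalSpace E] {f g : ι → E} {a b : E}
    (h : HasSum f a) (hfg : ∀ i, g i = f i) (hab : b = a) : HasSum g b := by
  have : g = f := funext hfg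
  rw [this, hab]; exact h

/-- The circle group. -/
abbrev TT : Type := AddCircle (2 * Real.pi)

/-- Normalized Haar measure on the circle. -/
abbrev mT : Measure TT := AddCircle.haarAddCircle

/-- Coefficients of the Poisson kernel. -/
def pk (z : ℂ) (n : ℤ) : ℂ := if 0 ≤ n then z ^ n.toNat else (conj z) ^ (-n).toNat

/-- The Poisson kernel. -/
def Pz (z : ℂ) (t : TT) : ℝ := (1 - ‖z‖ ^ 2) / ‖(fourier 1 t : ℂ) - z‖ ^ 2

/-- The Poisson extension. -/
def Pois (u : TT → ℂ) (z : ℂ) : ℂ := ∫ t, (Pz z t : ℂ) * u t ∂mT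

lemma norm_fourier (n : ℤ) (t : TT) : ‖(fourier n t : ℂ)‖ = 1 := by
  rw [fourier_apply]; exact Circle.norm_coe _

lemma fourier_nat (n : ℕ) (t : TT) : (fourier (n : ℤ) t : ℂ) = (fourier 1 t : ℂ) ^ n := by
  induction n with
  | zero => simp
  | succ n ih => push_cast; rw [fourier_add, ih, pow_succ]

lemma fourier_negnat (n : ℕ) (t : TT) : (fourier (-(n : ℤ)) t : ℂ) = (conj (fourier 1 t : ℂ)) ^ n := by
  rw [fourier_neg, fourier_nat, map_pow]

lemma Pz_nonneg {z : ℂ} (hz : ‖z‖ < 1) (t : TT) : 0 ≤ Pz z t := by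
  unfold Pz
  have : ‖z‖ ^ 2 ≤ 1 := by nlinarith [norm_nonneg z]
  apply div_nonneg <;> [linarith; positivity]

lemma sub_ne {z : ℂ} (hz : ‖z‖ < 1) (t : TT) : (fourier 1 t : ℂ) - z ≠ 0 := by
  intro h
  rw [sub_eq_zero] at h
  have := norm_fourier 1 t
  rw [h] at this; linarith

lemma Pz_continuous {z : ℂ} (hz : ‖z‖ < 1) : Continuous (Pz z) := by
  unfold Pz
  apply Continuous.div continuous_const (by fun_prop)
  intro t
  have := norm_pos_iff.mpr (sub_ne hz t)
  positivity

lemma Pz_hasSum {z : ℂ} (hz : ‖z‖ < 1) (t : TT) :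
    HasSum (fun n : ℤ => pk z n * fourier (-n) t) (Pz z t : ℂ) := by
  set w : ℂ := fourier 1 t with hw
  have hwn : ‖w‖ = 1 := norm_fourier 1 t
  have hww : w * conj w = 1 := by rw [Complex.mul_conj, Complex.normSq_eq_norm_sq, hwn]; simp
  have h1 : HasSum (fun n : ℕ => (z * conj w) ^ n) (1 - z * conj w)⁻¹ := by
    apply hasSum_geometric_of_norm_lt_one
    simp [hwn, hz]
  have h2 : HasSum (fun n : ℕ => (conj z * w) * (conj z * w) ^ n)
      ((conj z * w) * (1 - conj z * w)⁻¹) := by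
    apply HasSum.mul_left
    apply hasSum_geometric_of_norm_lt_one
    simp [hwn, hz]
  have key : (Pz z t : ℂ) = (1 - z * conj w)⁻¹ + (conj z * w) * (1 - conj z * w)⁻¹ := by
    have n1 : w - z ≠ 0 := sub_ne hz t
    have n2 : conj w - conj z ≠ 0 := by
      rw [← map_sub]; exact (map_ne_zero _).mpr n1
    have e1 : 1 - z * conj w = (w - z) * conj w := by linear_combination -hww
    have e2 : 1 - conj z * w = (conj w - conj z) * w := by linear_combination -hww
    have w0 : w ≠ 0 := by intro h; rw [h] at hwn; simp at hwn
    have w1 : conj w ≠ 0 := by simpa using w0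
    have : (Pz z t : ℂ) = (1 - z * conj z) / ((w - z) * (conj w - conj z)) := by
      unfold Pz
      rw [← hw]
      push_cast
      rw [← map_sub, Complex.mul_conj', Complex.mul_conj']
    rw [this, e1, e2]
    field_simp
    linear_combination (-conj z) * hww
  rw [key]
  apply HasSum.of_nat_of_neg_add_one
  · convert h1 using 2 with n
    rw [fourier_negnat, mul_pow, ← hw]; simp [pk]
  · convert h2 using 2 with n
    have hneg : ¬ (0 : ℤ) ≤ -((n : ℤ) + 1) := by omega
    have e : (-(-((n : ℤ) + 1))).toNat = n + 1 := by omega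
    have e' : (-(-((n : ℤ) + 1))) = ((n + 1 : ℕ) : ℤ) := by push_cast; ring
    simp only [pk, hneg, if_false]
    rw [e, e', fourier_nat, ← hw, ← pow_succ', mul_pow]

lemma norm_pk (z : ℂ) (n : ℤ) : ‖pk z n‖ = ‖z‖ ^ n.natAbs := by
  unfold pk
  split_ifs with h
  · rw [norm_pow]; congr 1; omega
  · rw [norm_pow, RCLike.norm_conj]; congr 1; omega

lemma summable_norm_pk {z : ℂ} (hz : ‖z‖ < 1) : Summable (fun n : ℤ => ‖pk z n‖) := by
  have hg := summable_geometric_of_lt_one (norm_nonneg z) hz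
  apply Summable.of_nat_of_neg_add_one
  · simpa [norm_pk] using hg
  · have := (summable_nat_add_iff 1).mpr hg
    refine this.congr fun n => ?_
    rw [norm_pk]; congr 1

lemma Pz_le {z : ℂ} (hz : ‖z‖ < 1) (t : TT) : ‖(Pz z t : ℂ)‖ ≤ ∑' n : ℤ, ‖pk z n‖ := by
  rw [← (Pz_hasSum hz t).tsum_eq]
  have : ∀ n : ℤ, ‖pk z n * (fourier (-n) t : ℂ)‖ = ‖pk z n‖ := by
    intro n; rw [norm_mul, norm_fourier, mul_one]
  have h2 : Summable (fun n : ℤ => ‖pk z n * (fourier (-n) t : ℂ)‖) := by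
    simpa only [this] using summable_norm_pk hz
  calc _ ≤ ∑' n : ℤ, ‖pk z n * (fourier (-n) t : ℂ)‖ := norm_tsum_le_tsum_norm h2
    _ = _ := by simp only [this]

lemma integrable_Pz_mul {z : ℂ} (hz : ‖z‖ < 1) {u : TT → ℂ} (hu : Integrable u mT) :
    Integrable (fun t => (Pz z t : ℂ) * u t) mT := by
  apply hu.bdd_mul (c := ∑' n : ℤ, ‖pk z n‖)
  · exact (Complex.continuous_ofReal.comp (Pz_continuous hz)).aestronglyMeasurable
  · exact Eventually.of_forall (Pz_le hz)

lemma Pois_hasSum {z : ℂ} (hz : ‖z‖ < 1) {u : TT → ℂ} (hu : Integrable u mT) :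
    HasSum (fun n : ℤ => pk z n * fourierCoeff u n) (Pois u z) := by
  have h := hasSum_integral_of_summable_integral_norm (μ := mT)
    (F := fun (n : ℤ) (t : TT) => pk z n * (fourier (-n) t * u t)) ?_ ?_
  · refine hsc h (fun n => ?_) ?_
    · rw [integral_const_mul]; rfl
    · unfold Pois
      congr 1
      funext t
      rw [← (Pz_hasSum hz t).tsum_eq, ← tsum_mul_right]
      simp only [mul_assoc]
  · intro n
    exact (hu.fourier_smul (-n)).const_mul _
  · have : ∀ n : ℤ, ∫ t, ‖pk z n * ((fourier (-n) t : ℂ) * u t)‖ ∂mT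
        = ‖pk z n‖ * ∫ t, ‖u t‖ ∂mT := by
      intro n
      rw [← integral_const_mul]
      congr 1
      funext t
      rw [norm_mul, norm_mul, norm_fourier, one_mul]
    simp only [this]
    exact (summable_norm_pk hz).mul_right _

lemma Pois_zero_of {z : ℂ} (hz : ‖z‖ < 1) {u : TT → ℂ} (hu : Integrable u mT)
    (h : ∀ n, fourierCoeff u n = 0) : Pois u z = 0 := by
  have := Pois_hasSum hz hu
  simp only [h, mul_zero] at this
  exact this.unique hasSum_zero

/-- Square integrable functions with no negative Fourier coefficients. -/
def A2 (u : TT → ℂ) : Prop := MemLp u 2 mT ∧ ∀ n : ℤ, n < 0 → fourierCoeff u n = 0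

lemma memLp_integrable {u : TT → ℂ} (hu : MemLp u 2 mT) : Integrable u mT :=
  hu.integrable (by norm_num)

lemma Pois_hasSum_nat {z : ℂ} (hz : ‖z‖ < 1) {u : TT → ℂ} (hu : Integrable u mT)
    (h : ∀ n : ℤ, n < 0 → fourierCoeff u n = 0) :
    HasSum (fun n : ℕ => z ^ n * fourierCoeff u n) (Pois u z) := by
  have h1 := Pois_hasSum hz hu
  have h2 : Function.Injective (fun n : ℕ => (n : ℤ)) := Nat.cast_injective
  rw [← h2.hasSum_iff] at h1
  · convert h1 using 2 with n
    simp [pk]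
  · intro n hn
    rw [h n, mul_zero]
    by_contra hc
    exact hn ⟨n.toNat, by simp; omega⟩

lemma fourierCoeff_memLp {u : TT → ℂ} (hu : MemLp u 2 mT) (n : ℤ) :
    inner ℂ (fourierBasis n) (hu.toLp u) = fourierCoeff u n := by
  rw [← HilbertBasis.repr_apply_apply, fourierBasis_repr]
  rw [fourierCoeff_congr_ae hu.coeFn_toLp]

lemma parseval {u v : TT → ℂ} (hu : MemLp u 2 mT) (hv : MemLp v 2 mT) :
    HasSum (fun k : ℤ => conj (fourierCoeff v k) * fourierCoeff u k)
      (∫ t, conj (v t) * u t ∂mT) := by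
  have h := HilbertBasis.hasSum_inner_mul_inner fourierBasis (hv.toLp v) (hu.toLp u)
  have e : inner ℂ (hv.toLp v) (hu.toLp u) = ∫ t, conj (v t) * u t ∂mT := by
    rw [L2.inner_def]
    apply integral_congr_ae
    filter_upwards [hu.coeFn_toLp, hv.coeFn_toLp] with t h1 h2
    rw [h1, h2]; simp [mul_comm]
  rw [e] at h
  refine hsc h (fun k => ?_) rfl
  rw [fourierCoeff_memLp hu, ← inner_conj_symm, fourierCoeff_memLp hv]

lemma memLp_fourier_mul {u : TT → ℂ} (hu : MemLp u 2 mT) (n : ℤ) :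
    MemLp (fun t => (fourier n t : ℂ) * u t) 2 mT := by
  have : AEStronglyMeasurable (fun t => (fourier n t : ℂ) * u t) mT :=
    (fourier n).continuous.aestronglyMeasurable.mul hu.1
  refine (memLp_congr_norm hu.1 this ?_).1 hu
  refine Eventually.of_forall fun t => ?_
  rw [norm_mul, norm_fourier, one_mul]

lemma fourierCoeff_fourier_mul (u : TT → ℂ) (n k : ℤ) :
    fourierCoeff (fun t => (fourier n t : ℂ) * u t) k = fourierCoeff u (k - n) := by
  unfold fourierCoeff
  congr 1; funext t
  rw [smul_eq_mul, smul_eq_mul, ← mul_assoc, ← fourier_add]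
  congr 3; ring

lemma memLp_conj {u : TT → ℂ} (hu : MemLp u 2 mT) : MemLp (fun t => conj (u t)) 2 mT := hu.star

lemma fourierCoeff_conj (u : TT → ℂ) (n : ℤ) :
    fourierCoeff (fun t => conj (u t)) n = conj (fourierCoeff u (-n)) := by
  unfold fourierCoeff
  rw [← integral_conj]
  congr 1; funext t
  simp only [smul_eq_mul, map_mul, fourier_neg, neg_neg]

/-- Fourier coefficients of `conj u * v`. -/
lemma fourierCoeff_conj_mul {u v : TT → ℂ} (hu : MemLp u 2 mT) (hv : MemLp v 2 mT) (n : ℤ) :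
    HasSum (fun k : ℤ => conj (fourierCoeff u k) * fourierCoeff v (k + n))
      (fourierCoeff (fun t => conj (u t) * v t) n) := by
  have h := parseval (memLp_fourier_mul hv (-n)) hu
  convert h using 1
  · funext k; rw [fourierCoeff_fourier_mul]; congr 2; ring
  · unfold fourierCoeff
    congr 1; funext t; simp only [smul_eq_mul]; ring

lemma fourierCoeff_mul {u v : TT → ℂ} (hu : MemLp u 2 mT) (hv : MemLp v 2 mT) (n : ℤ) :
    HasSum (fun k : ℤ => fourierCoeff u k * fourierCoeff v (n - k))
      (fourierCoeff (fun t => u t * v t) n) := by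
  have h := fourierCoeff_conj_mul (memLp_conj hu) hv n
  simp only [fourierCoeff_conj, Complex.conj_conj] at h
  rw [← (Equiv.neg ℤ).hasSum_iff] at h
  convert h using 2 with k
  simp [sub_eq_neg_add]

lemma A2_mul_coeff_neg {u v : TT → ℂ} (hu : A2 u) (hv : A2 v) (n : ℤ) (hn : n < 0) :
    fourierCoeff (fun t => u t * v t) n = 0 := by
  have h := fourierCoeff_mul hu.1 hv.1 n
  refine h.unique ?_
  convert hasSum_zero using 2 with k
  rcases lt_or_ge k 0 with hk | hk
  · rw [hu.2 k hk, zero_mul]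
  · rw [hv.2 (n - k) (by omega), mul_zero]

lemma A2_mul_coeff {u v : TT → ℂ} (hu : A2 u) (hv : A2 v) (n : ℕ) :
    fourierCoeff (fun t => u t * v t) n
      = ∑ k ∈ Finset.range (n + 1), fourierCoeff u k * fourierCoeff v ((n - k : ℕ) : ℤ) := by
  have h := fourierCoeff_mul hu.1 hv.1 n
  have h2 : Function.Injective (fun n : ℕ => (n : ℤ)) := Nat.cast_injective
  rw [← h2.hasSum_iff] at h
  · refine h.unique ?_
    have := hasSum_sum_of_ne_finset_zero (L := SummationFilter.unconditional ℕ) (s := Finset.range (n + 1))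
      (f := (fun k : ℤ => fourierCoeff u k * fourierCoeff v (n - k)) ∘ fun n : ℕ => (n : ℤ)) ?_
    · convert this using 1
      apply Finset.sum_congr rfl
      intro k hk
      simp only [Finset.mem_range] at hk
      simp only [Function.comp]
      rw [Nat.cast_sub (by omega)]
    · intro k hk
      simp only [Finset.mem_range] at hk
      simp only [Function.comp]
      rw [hv.2 (n - k) (by omega), mul_zero]
  · intro k hk
    rw [hu.2 k, zero_mul]
    by_contra hc
    exact hk ⟨k.toNat, by simp; omega⟩

lemma summable_norm_eval {z : ℂ} (hz : ‖z‖ < 1) {u : TT → ℂ} (hu : Integrable u mT)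
    (h : ∀ n : ℤ, n < 0 → fourierCoeff u n = 0) :
    Summable (fun n : ℕ => ‖z ^ n * fourierCoeff u n‖) :=
  (Pois_hasSum_nat hz hu h).summable.norm

/-- Multiplicativity of the Poisson extension on `H²`. -/
theorem Pois_mul {z : ℂ} (hz : ‖z‖ < 1) {u v : TT → ℂ} (hu : A2 u) (hv : A2 v) :
    Pois (fun t => u t * v t) z = Pois u z * Pois v z := by
  have iu := memLp_integrable hu.1
  have iv := memLp_integrable hv.1
  have iuv : Integrable (fun t => u t * v t) mT := hu.1.integrable_mul hv.1
  rw [← (Pois_hasSum_nat hz iuv (A2_mul_coeff_neg hu hv)).tsum_eq,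
    ← (Pois_hasSum_nat hz iu hu.2).tsum_eq, ← (Pois_hasSum_nat hz iv hv.2).tsum_eq,
    tsum_mul_tsum_eq_tsum_sum_range_of_summable_norm (summable_norm_eval hz iu hu.2)
      (summable_norm_eval hz iv hv.2)]
  congr 1; funext n
  rw [A2_mul_coeff hu hv, Finset.mul_sum]
  apply Finset.sum_congr rfl
  intro k hk
  simp only [Finset.mem_range] at hk
  have : z ^ n = z ^ k * z ^ (n - k) := by rw [← pow_add]; congr 1; omega
  rw [this]; ring

/-- Riesz--Fischer. -/
lemma riesz_fischer (c : ℤ → ℂ) (hc : Summable (fun n => ‖c n‖ ^ 2)) :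
    ∃ u : TT → ℂ, MemLp u 2 mT ∧ ∀ n, fourierCoeff u n = c n := by
  have hm : Memℓp c 2 := by
    apply memℓp_gen
    simpa using hc
  let F : Lp ℂ 2 mT := (fourierBasis (T := 2 * Real.pi)).repr.symm ⟨c, hm⟩
  refine ⟨F, Lp.memLp F, fun n => ?_⟩
  rw [← fourierBasis_repr]
  simp [F]

/-- Parseval identity. -/
lemma parseval_norm {u : TT → ℂ} (hu : MemLp u 2 mT) :
    HasSum (fun k : ℤ => ‖fourierCoeff u k‖ ^ 2) (∫ t, ‖u t‖ ^ 2 ∂mT) := by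
  have h := hasSum_sq_fourierCoeff (hu.toLp u)
  convert h using 1
  · funext k; rw [fourierCoeff_congr_ae hu.coeFn_toLp]
  · apply integral_congr_ae
    filter_upwards [hu.coeFn_toLp] with t h1
    rw [h1]

end

end OuterProof

namespace OuterProof

open ComplexConjugate

noncomputable section

lemma dist_lower (s t : TT) {r : ℝ} (h1 : 1 / 2 ≤ r) :
    (1 - r) ^ 2 + ‖s - t‖ ^ 2 / 5 ≤ ‖(fourier 1 s : ℂ) - r * fourier 1 t‖ ^ 2 := by
  have hx : ∃ x : ℝ, (x : TT) = s - t ∧ ‖s - t‖ = |x| ∧ |x| ≤ Real.pi := by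
    obtain ⟨x, hx, hx2⟩ : ∃ x : ℝ, x ∈ Set.Ioc (-Real.pi) (-Real.pi + 2 * Real.pi) ∧ (x : TT) = s - t := by
      have := AddCircle.coe_image_Ioc_eq (2 * Real.pi) (-Real.pi)
      have hm : s - t ∈ ((↑) : ℝ → TT) '' Set.Ioc (-Real.pi) (-Real.pi + 2 * Real.pi) := by
        rw [this]; trivial
      exact hm
    have hab : |x| ≤ Real.pi := abs_le.mpr ⟨hx.1.le, by linarith [hx.2]⟩
    refine ⟨x, hx2, ?_, hab⟩
    rw [← hx2, (AddCircle.norm_coe_eq_abs_iff (2 * Real.pi) Real.two_pi_pos.ne').mpr]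
    rw [abs_of_pos Real.two_pi_pos]; linarith
  obtain ⟨x, hx, hn, hxp⟩ := hx
  have hs : (fourier 1 s : ℂ) = fourier 1 (x : TT) * fourier 1 t := by
    have : s = (x : TT) + t := by rw [hx]; abel
    rw [this, fourier_one, fourier_one, fourier_one, AddCircle.toCircle_add]; simp
  rw [hs, ← sub_mul, norm_mul, norm_fourier, mul_one, hn, sq_abs]
  have he : (fourier 1 (x : TT) : ℂ) = Real.cos x + Real.sin x * Complex.I := by
    rw [fourier_coe_apply]
    have : (2 * Real.pi * Complex.I * (1 : ℤ) * x / ((2 * Real.pi : ℝ) : ℂ)) = x * Complex.I := by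
      have := Real.pi_pos.ne'
      push_cast
      field_simp
    rw [this, Complex.exp_mul_I]; push_cast; rfl
  have hq : ‖(fourier 1 (x : TT) : ℂ) - r‖ ^ 2 = (1 - r) ^ 2 + 2 * r * (1 - Real.cos x) := by
    rw [he, ← Complex.normSq_eq_norm_sq, Complex.normSq_apply]
    simp only [Complex.add_re, Complex.sub_re, Complex.sub_im, Complex.add_im, Complex.mul_re,
      Complex.mul_im, Complex.ofReal_re, Complex.ofReal_im, Complex.I_re, Complex.I_im]
    nlinarith [Real.sin_sq_add_cos_sq x]
  rw [hq]
  have hc := Real.cos_le_one_sub_mul_cos_sq hxp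
  have hpi : (1 : ℝ) / 5 ≤ 2 / Real.pi ^ 2 := by
    rw [div_le_div_iff₀ (by norm_num) (by positivity)]
    nlinarith [Real.pi_lt_d2, Real.pi_pos]
  have h3 : x ^ 2 / 5 ≤ 1 - Real.cos x := by nlinarith [sq_nonneg x]
  have h4 : 0 ≤ 1 - Real.cos x := by linarith [Real.cos_le_one x]
  nlinarith

lemma Pz_bounds (s t : TT) {r : ℝ} (h1 : 1 / 2 ≤ r) (h2 : r < 1) {k : ℕ}
    (hk : k = 0 ∨ 2 ^ k * (1 - r) < 2 * ‖s - t‖) :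
    Pz (r * fourier 1 t) s ≤ 40 * (1 / 2) ^ k * (2 ^ k * (1 - r))⁻¹ := by
  have hd := dist_lower s t h1
  have hr : 0 < 1 - r := by linarith
  have hz : ‖(r : ℂ) * fourier 1 t‖ = r := by
    rw [norm_mul, norm_fourier, mul_one, Complex.norm_real, Real.norm_eq_abs, abs_of_pos (by linarith)]
  unfold Pz
  rw [hz]
  set D := ‖(fourier 1 s : ℂ) - r * fourier 1 t‖ ^ 2
  have hD : 0 < D := by nlinarith [sq_nonneg ‖s - t‖]
  have e : 40 * (1 / 2 : ℝ) ^ k * (2 ^ k * (1 - r))⁻¹ = 40 / ((2 ^ k) ^ 2 * (1 - r)) := by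
    rw [one_div, inv_pow]; field_simp
  rw [e, div_le_div_iff₀ hD (by positivity)]
  rcases hk with rfl | hk
  · simp only [pow_zero]
    nlinarith [sq_nonneg ‖s - t‖]
  · have h3 : (2 ^ k * (1 - r)) ^ 2 ≤ (2 * ‖s - t‖) ^ 2 := by
      apply pow_le_pow_left₀ (by positivity) hk.le
    nlinarith

lemma Pz_dyadic (s t : TT) {r : ℝ} (h1 : 1 / 2 ≤ r) (h2 : r < 1) {K : ℕ}
    (hK : Real.pi ≤ 2 ^ K * (1 - r)) :
    Pz (r * fourier 1 t) s ≤ ∑ k ∈ Finset.range (K + 1),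
      (40 * (1 / 2) ^ k * (2 ^ k * (1 - r))⁻¹) *
        (Metric.closedBall t (2 ^ k * (1 - r))).indicator (fun _ => (1 : ℝ)) s := by
  have hr : 0 < 1 - r := by linarith
  have hex : ∃ k : ℕ, ‖s - t‖ ≤ 2 ^ k * (1 - r) := by
    refine ⟨K, le_trans ?_ hK⟩
    have := AddCircle.norm_le_half_period (2 * Real.pi) Real.two_pi_pos.ne' (x := s - t)
    rw [abs_of_pos Real.two_pi_pos] at this
    linarith
  have hKle : Nat.find hex ≤ K := by
    apply Nat.find_min'
    have := AddCircle.norm_le_half_period (2 * Real.pi) Real.two_pi_pos.ne' (x := s - t)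
    rw [abs_of_pos Real.two_pi_pos] at this
    linarith
  set k := Nat.find hex with hkdef
  have hk1 : ‖s - t‖ ≤ 2 ^ k * (1 - r) := Nat.find_spec hex
  have hk2 : k = 0 ∨ 2 ^ k * (1 - r) < 2 * ‖s - t‖ := by
    rcases Nat.eq_zero_or_pos k with h | h
    · exact Or.inl h
    · right
      have := Nat.find_min hex (m := k - 1) (by omega)
      push Not at this
      have e : (2 : ℝ) ^ k = 2 * 2 ^ (k - 1) := by rw [← pow_succ']; congr 1; omega
      rw [e]; linarith
  calc _ ≤ (40 * (1 / 2) ^ k * (2 ^ k * (1 - r))⁻¹) *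
        (Metric.closedBall t (2 ^ k * (1 - r))).indicator (fun _ => (1 : ℝ)) s := by
          rw [Set.indicator_of_mem, mul_one]
          · exact Pz_bounds s t h1 h2 hk2
          · rw [Metric.mem_closedBall, dist_eq_norm]; exact hk1
    _ ≤ _ := by
      apply Finset.single_le_sum (f := fun k : ℕ => (40 * (1 / 2 : ℝ) ^ k * (2 ^ k * (1 - r))⁻¹) *
        (Metric.closedBall t (2 ^ k * (1 - r))).indicator (fun _ => (1 : ℝ)) s)
      · intro i _
        apply mul_nonneg (by positivity)
        apply Set.indicator_nonneg; intros; norm_num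
      · simp; omega

/-- Averages over small balls. -/
def mAvg (w : TT → ℝ) (t : TT) (x : ℝ) : ℝ := x⁻¹ * ∫ s in Metric.closedBall t x, w s ∂mT

lemma Pz_integral_le {w : TT → ℝ} (hw : Integrable w mT) (hw0 : ∀ s, 0 ≤ w s) (t : TT) {r : ℝ}
    (h1 : 1 / 2 ≤ r) (h2 : r < 1) (hs : Summable (fun k : ℕ => 40 * (1 / 2 : ℝ) ^ k * mAvg w t (2 ^ k * (1 - r)))) :
    ∫ s, Pz (r * fourier 1 t) s * w s ∂mT ≤ ∑' k : ℕ, 40 * (1 / 2) ^ k * mAvg w t (2 ^ k * (1 - r)) := by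
  have hr : 0 < 1 - r := by linarith
  obtain ⟨K, hK⟩ : ∃ K : ℕ, Real.pi ≤ 2 ^ K * (1 - r) := by
    obtain ⟨K, hK⟩ := pow_unbounded_of_one_lt (Real.pi / (1 - r)) (by norm_num : (1 : ℝ) < 2)
    exact ⟨K, by rw [div_lt_iff₀ hr] at hK; exact hK.le⟩
  have hnn : ∀ k : ℕ, 0 ≤ 40 * (1 / 2 : ℝ) ^ k * mAvg w t (2 ^ k * (1 - r)) := by
    intro k
    apply mul_nonneg (by positivity)
    apply mul_nonneg (by positivity)
    exact integral_nonneg hw0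
  have hitg : ∀ k : ℕ, Integrable (fun s => (40 * (1 / 2 : ℝ) ^ k * (2 ^ k * (1 - r))⁻¹) *
        (Metric.closedBall t (2 ^ k * (1 - r))).indicator w s) mT := fun k =>
    (hw.indicator Metric.isClosed_closedBall.measurableSet).const_mul _
  calc ∫ s, Pz (r * fourier 1 t) s * w s ∂mT
      ≤ ∫ s, ∑ k ∈ Finset.range (K + 1), (40 * (1 / 2 : ℝ) ^ k * (2 ^ k * (1 - r))⁻¹) *
        (Metric.closedBall t (2 ^ k * (1 - r))).indicator w s ∂mT := by
        apply integral_mono_of_nonneg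
        · refine Eventually.of_forall fun s => mul_nonneg (Pz_nonneg ?_ s) (hw0 s)
          rw [norm_mul, norm_fourier, mul_one, Complex.norm_real, Real.norm_eq_abs,
            abs_of_pos (by linarith)]
          exact h2
        · exact integrable_finsetSum _ fun k _ => hitg k
        · refine Eventually.of_forall fun s => ?_
          have := mul_le_mul_of_nonneg_right (Pz_dyadic s t h1 h2 hK) (hw0 s)
          refine this.trans (le_of_eq ?_)
          rw [Finset.sum_mul]
          apply Finset.sum_congr rfl
          intro k _
          by_cases hm : s ∈ Metric.closedBall t (2 ^ k * (1 - r))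
          · simp only [Set.indicator_of_mem hm, mul_one]
          · simp only [Set.indicator_of_notMem hm, mul_zero, zero_mul]
    _ = ∑ k ∈ Finset.range (K + 1), 40 * (1 / 2) ^ k * mAvg w t (2 ^ k * (1 - r)) := by
        rw [integral_finsetSum _ fun k _ => hitg k]
        apply Finset.sum_congr rfl
        intro k _
        rw [integral_const_mul, integral_indicator Metric.isClosed_closedBall.measurableSet]
        unfold mAvg; ring
    _ ≤ _ := hs.sum_le_tsum _ fun k _ => hnn k

lemma tendsto_dyadic {m : ℝ → ℝ} {M : ℝ} (hm : Tendsto m (𝓝[>] 0) (𝓝 0))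
    (hM : ∀ x, 0 < x → |m x| ≤ M) :
    Tendsto (fun r : ℝ => ∑' k : ℕ, 40 * (1 / 2 : ℝ) ^ k * m (2 ^ k * (1 - r))) (𝓝[<] 1) (𝓝 0) := by
  have hb : Summable (fun k : ℕ => 40 * (1 / 2 : ℝ) ^ k * M) :=
    ((summable_geometric_of_lt_one (by norm_num) (by norm_num)).mul_left 40).mul_right M
  have h := tendsto_tsum_of_dominated_convergence (𝓕 := 𝓝[<] (1 : ℝ))
    (f := fun (r : ℝ) (k : ℕ) => 40 * (1 / 2 : ℝ) ^ k * m (2 ^ k * (1 - r))) (g := fun _ => 0) hb ?_ ?_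
  · simpa using h
  · intro k
    have h1 : Tendsto (fun r : ℝ => 2 ^ k * (1 - r)) (𝓝[<] 1) (𝓝[>] 0) := by
      rw [tendsto_nhdsWithin_iff]
      constructor
      · have : Tendsto (fun r : ℝ => 2 ^ k * (1 - r)) (𝓝 1) (𝓝 (2 ^ k * (1 - 1))) :=
          (Continuous.tendsto (by fun_prop) 1)
        rw [sub_self, mul_zero] at this
        exact this.mono_left nhdsWithin_le_nhds
      · filter_upwards [self_mem_nhdsWithin] with r hr
        have : 0 < 1 - r := sub_pos.mpr hr
        exact mul_pos (by positivity) this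
    simpa using (hm.comp h1).const_mul (40 * (1 / 2 : ℝ) ^ k)
  · filter_upwards [self_mem_nhdsWithin] with r hr k
    have : 0 < 1 - r := sub_pos.mpr hr
    rw [norm_mul, Real.norm_eq_abs, Real.norm_eq_abs, abs_of_nonneg (by positivity : (0:ℝ) ≤ 40 * (1 / 2) ^ k)]
    exact mul_le_mul_of_nonneg_left (hM _ (by positivity)) (by positivity)

lemma ae_mT_iff {p : TT → Prop} : (∀ᵐ t ∂mT, p t) ↔ ∀ᵐ t ∂(volume : Measure TT), p t := by
  rw [AddCircle.volume_eq_smul_haarAddCircle]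
  rw [Measure.ae_ennreal_smul_measure_iff]
  simp [Real.pi_pos]

lemma Pz_integral_one {z : ℂ} (hz : ‖z‖ < 1) : Pois (fun _ => 1) z = 1 := by
  have h1 : ∀ n : ℤ, fourierCoeff (fun _ : TT => (1 : ℂ)) n = if n = 0 then 1 else 0 := by
    intro n
    have := congrFun (fourierCoeff_fourier (T := 2 * Real.pi) 0) n
    simp only [Pi.single_apply] at this
    rw [← this]
    congr 1; funext t; simp
  have := Pois_hasSum_nat hz (u := fun _ => 1) (integrable_const 1) (by
    intro n hn; rw [h1, if_neg hn.ne])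
  refine this.unique ?_
  have h2 := hasSum_ite_eq (0 : ℕ) (1 : ℂ)
  refine hsc h2 (fun n => ?_) rfl
  rw [h1]
  by_cases hn : n = 0 <;> simp [hn]

theorem fatou {u : TT → ℂ} (hu : Integrable u mT) :
    ∀ᵐ t ∂mT, Tendsto (fun r : ℝ => Pois u (r * fourier 1 t)) (𝓝[<] 1) (𝓝 (u t)) := by
  have huv : Integrable u (volume : Measure TT) := by
    rw [AddCircle.volume_eq_smul_haarAddCircle]
    exact hu.smul_measure ENNReal.ofReal_ne_top
  rw [ae_mT_iff]
  filter_upwards [IsUnifLocDoublingMeasure.ae_tendsto_average_norm_sub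
    (volume : Measure TT) huv.locallyIntegrable 1] with t ht
  have ht1 := ht (ι := ℝ) (l := 𝓝[>] 0) (fun _ => t) id tendsto_id (by
    filter_upwards [self_mem_nhdsWithin] with x hx
    simpa using (le_of_lt (hx : (0:ℝ) < x)))
  set w : TT → ℝ := fun s => ‖u s - u t‖ with hwdef
  have hw : Integrable w mT := (hu.sub (integrable_const _)).norm
  have hw0 : ∀ s, 0 ≤ w s := fun s => norm_nonneg _
  have hmt : Tendsto (mAvg w t) (𝓝[>] 0) (𝓝 0) := by
    have h3 : ∀ᶠ x in 𝓝[>] (0 : ℝ), mAvg w t x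
        = Real.pi⁻¹ * ⨍ y in Metric.closedBall t (id x), ‖u y - u t‖ ∂volume := by
      have : Set.Ioo (0 : ℝ) Real.pi ∈ 𝓝[>] (0 : ℝ) := Ioo_mem_nhdsGT Real.pi_pos
      filter_upwards [this] with x hx
      rw [setAverage_eq, id, measureReal_def, AddCircle.volume_closedBall,
        min_eq_right (by linarith [hx.2]), ENNReal.toReal_ofReal (by linarith [hx.1]), smul_eq_mul]
      unfold mAvg
      rw [← integral_indicator Metric.isClosed_closedBall.measurableSet,
        ← integral_indicator Metric.isClosed_closedBall.measurableSet,
        AddCircle.integral_haarAddCircle, smul_eq_mul]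
      have := hx.1.ne'
      have := Real.pi_pos.ne'
      field_simp
      rfl
    rw [tendsto_congr' h3]
    simpa using ht1.const_mul Real.pi⁻¹
  obtain ⟨M, hM⟩ : ∃ M, ∀ x, 0 < x → |mAvg w t x| ≤ M := by
    have h4 : ∀ᶠ x in 𝓝[>] (0 : ℝ), |mAvg w t x| < 1 := by
      have := hmt.abs
      rw [abs_zero] at this
      exact this.eventually_lt_const one_pos
    rw [eventually_nhdsWithin_iff, Metric.eventually_nhds_iff] at h4
    obtain ⟨η, hη, h4⟩ := h4
    refine ⟨max 1 (η⁻¹ * ∫ s, w s ∂mT), fun x hx => ?_⟩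
    rcases lt_or_ge x η with h | h
    · refine le_max_of_le_left (h4 ?_ hx).le
      rw [Real.dist_eq, sub_zero, abs_of_pos hx]; exact h
    · refine le_max_of_le_right ?_
      unfold mAvg
      rw [abs_of_nonneg (mul_nonneg (by positivity) (integral_nonneg hw0))]
      apply mul_le_mul
      · exact inv_anti₀ hη h
      · exact setIntegral_le_integral hw (Eventually.of_forall hw0)
      · exact integral_nonneg hw0
      · positivity
  have hlim := tendsto_dyadic hmt hM
  rw [tendsto_iff_norm_sub_tendsto_zero]
  refine squeeze_zero' (Eventually.of_forall fun r => norm_nonneg _) ?_ hlim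
  have hI : Set.Ico (1 / 2 : ℝ) 1 ∈ 𝓝[<] (1 : ℝ) := Ico_mem_nhdsLT (by norm_num)
  filter_upwards [hI] with r hr
  have hrp : 0 < 1 - r := by linarith [hr.2]
  have hz : ‖(r : ℂ) * fourier 1 t‖ < 1 := by
    rw [norm_mul, norm_fourier, mul_one, Complex.norm_real, Real.norm_eq_abs,
            abs_of_pos (by linarith [hr.1])]
    exact hr.2
  have e : Pois u (r * fourier 1 t) - u t
      = ∫ s, (Pz (r * fourier 1 t) s : ℂ) * (u s - u t) ∂mT := by
    have h5 : u t = ∫ s, (Pz (r * fourier 1 t) s : ℂ) * u t ∂mT := by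
      have := Pz_integral_one hz
      unfold Pois at this
      simp only [mul_one] at this
      rw [integral_mul_const, this, one_mul]
    conv_lhs => rw [h5]
    unfold Pois
    rw [← integral_sub (integrable_Pz_mul hz hu) (integrable_Pz_mul hz (integrable_const _))]
    simp only [mul_sub]
  rw [e]
  refine (norm_integral_le_integral_norm _).trans ?_
  refine le_trans (le_of_eq ?_) (Pz_integral_le hw hw0 t hr.1 hr.2 ?_)
  · congr 1; funext s
    rw [norm_mul, Complex.norm_real, Real.norm_eq_abs, abs_of_nonneg (Pz_nonneg hz s)]
  · apply Summable.of_norm_bounded (g := fun k : ℕ => 40 * (1 / 2 : ℝ) ^ k * M)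
    · exact ((summable_geometric_of_lt_one (by norm_num) (by norm_num)).mul_left 40).mul_right M
    · intro k
      rw [norm_mul, Real.norm_eq_abs, Real.norm_eq_abs, abs_of_nonneg (by positivity : (0:ℝ) ≤ 40 * (1 / 2) ^ k)]
      exact mul_le_mul_of_nonneg_left (hM _ (by positivity)) (by positivity)

/-- Uniqueness of Fourier coefficients for integrable functions. -/
theorem ae_zero_of_fourierCoeff {u : TT → ℂ} (hu : Integrable u mT)
    (h : ∀ n, fourierCoeff u n = 0) : ∀ᵐ t ∂mT, u t = 0 := by
  filter_upwards [fatou hu] with t ht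
  refine tendsto_nhds_unique ht ?_
  refine tendsto_const_nhds.congr' ?_
  have hI : Set.Ico (1 / 2 : ℝ) 1 ∈ 𝓝[<] (1 : ℝ) := Ico_mem_nhdsLT (by norm_num)
  filter_upwards [hI] with r hr
  symm
  apply Pois_zero_of _ hu h
  rw [norm_mul, norm_fourier, mul_one, Complex.norm_real, Real.norm_eq_abs,
            abs_of_pos (by linarith [hr.1])]
  exact hr.2

end

end OuterProof

namespace OuterProof
open scoped ComplexConjugate
noncomputable section

/-- Complexified quaternions. -/
abbrev QC : Type := Quaternion ℂ

/-- Constructor. -/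
def mk4 (a b c d : ℂ) : QC := ⟨a, b, c, d⟩

/-- Constructor. -/
def mr4 (a b c d : ℝ) : Quaternion ℝ := ⟨a, b, c, d⟩

@[simp] lemma mk4_re (a b c d : ℂ) : (mk4 a b c d).re = a := rfl
@[simp] lemma mk4_imI (a b c d : ℂ) : (mk4 a b c d).imI = b := rfl
@[simp] lemma mk4_imJ (a b c d : ℂ) : (mk4 a b c d).imJ = c := rfl
@[simp] lemma mk4_imK (a b c d : ℂ) : (mk4 a b c d).imK = d := rfl
@[simp] lemma mr4_re (a b c d : ℝ) : (mr4 a b c d).re = a := rfl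
@[simp] lemma mr4_imI (a b c d : ℝ) : (mr4 a b c d).imI = b := rfl
@[simp] lemma mr4_imJ (a b c d : ℝ) : (mr4 a b c d).imJ = c := rfl
@[simp] lemma mr4_imK (a b c d : ℝ) : (mr4 a b c d).imK = d := rfl

/-- Determinant-like norm form. -/
def dt (X : QC) : ℂ := X.re ^ 2 + X.imI ^ 2 + X.imJ ^ 2 + X.imK ^ 2

/-- Componentwise complex conjugation. -/
def cj (X : QC) : QC := mk4 (conj X.re) (conj X.imI) (conj X.imJ) (conj X.imK)

/-- Adjoint. -/
def ad (X : QC) : QC := star (cj X)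

/-- Hilbert space norm square. -/
def NN (X : QC) : ℝ := ‖X.re‖ ^ 2 + ‖X.imI‖ ^ 2 + ‖X.imJ‖ ^ 2 + ‖X.imK‖ ^ 2

/-- The embedding of real quaternions. -/
def up (q : Quaternion ℝ) : QC := mk4 q.re q.imI q.imJ q.imK

/-- scalars -/
def sc (c : ℂ) : QC := mk4 c 0 0 0

lemma sc_mul (c : ℂ) (X : QC) : sc c * X = mk4 (c * X.re) (c * X.imI) (c * X.imJ) (c * X.imK) := by
  unfold sc; ext <;> simp

lemma sc_comm (c : ℂ) (X : QC) : sc c * X = X * sc c := by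
  unfold sc; ext <;> simp <;> ring

lemma sc_sc (c d : ℂ) : sc c * sc d = sc (c * d) := by
  unfold sc; ext <;> simp

lemma mul_star_eq (X : QC) : X * star X = sc (dt X) := by
  unfold sc dt; ext <;> simp <;> ring

lemma star_mul_eq (X : QC) : star X * X = sc (dt X) := by
  unfold sc dt; ext <;> simp <;> ring

lemma dt_mul (X Y : QC) : dt (X * Y) = dt X * dt Y := by
  unfold dt; simp; ring

lemma dt_star (X : QC) : dt (star X) = dt X := by
  unfold dt; simp

lemma cj_mul (X Y : QC) : cj (X * Y) = cj X * cj Y := by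
  unfold cj; ext <;> simp

lemma cj_star (X : QC) : cj (star X) = star (cj X) := by
  unfold cj; ext <;> simp

lemma cj_cj (X : QC) : cj (cj X) = X := by
  unfold cj; ext <;> simp

lemma ad_mul (X Y : QC) : ad (X * Y) = ad Y * ad X := by
  unfold ad; rw [cj_mul, star_mul]

lemma ad_ad (X : QC) : ad (ad X) = X := by
  unfold ad; rw [cj_star, star_star, cj_cj]

lemma ad_star (X : QC) : ad (star X) = star (ad X) := by
  unfold ad; rw [cj_star]

lemma ad_sc (c : ℂ) : ad (sc c) = sc (conj c) := by
  unfold ad cj sc; ext <;> simp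

lemma dt_cj (X : QC) : dt (cj X) = conj (dt X) := by
  unfold dt cj; simp

lemma dt_ad (X : QC) : dt (ad X) = conj (dt X) := by
  unfold ad; rw [dt_star, dt_cj]

lemma NN_eq (X : QC) : (X * ad X).re = (NN X : ℂ) := by
  unfold NN ad cj
  simp only [Quaternion.re_mul, Quaternion.re_star, Quaternion.imI_star, Quaternion.imJ_star,
    Quaternion.imK_star, mk4_re, mk4_imI, mk4_imJ, mk4_imK]
  push_cast
  simp only [← Complex.mul_conj']
  ring

lemma NN_nonneg (X : QC) : 0 ≤ NN X := by unfold NN; positivity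

lemma NN_sc_mul (c : ℂ) (X : QC) : NN (sc c * X) = ‖c‖ ^ 2 * NN X := by
  rw [sc_mul]; unfold NN; simp only [mk4_re, mk4_imI, mk4_imJ, mk4_imK, norm_mul]; ring

lemma NN_mul_right {K : QC} {c : ℝ} (h : K * ad K = sc c) (X : QC) : NN (X * K) = c * NN X := by
  have h1 := NN_eq (X * K)
  rw [ad_mul, mul_assoc, ← mul_assoc K, h, ← mul_assoc, ← sc_comm, mul_assoc, sc_mul] at h1
  simp only [mk4_re, NN_eq] at h1
  exact_mod_cast h1.symm

lemma norm_dt_le (X : QC) : ‖dt X‖ ≤ NN X := by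
  unfold dt NN
  refine (norm_add_le _ _).trans (add_le_add ((norm_add_le _ _).trans (add_le_add
    ((norm_add_le _ _).trans (add_le_add ?_ ?_)) ?_)) ?_) <;> rw [norm_pow]

lemma up_mul (p q : Quaternion ℝ) : up (p * q) = up p * up q := by
  unfold up; ext <;> simp

lemma up_star (p : Quaternion ℝ) : up (star p) = star (up p) := by
  unfold up; ext <;> simp

lemma NN_up (p : Quaternion ℝ) : NN (up p) = ‖p‖ ^ 2 := by
  have := Quaternion.normSq_eq_norm_mul_self p
  rw [Quaternion.normSq_def'] at this
  unfold NN up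
  simp only [mk4_re, mk4_imI, mk4_imJ, mk4_imK, Complex.norm_real, Real.norm_eq_abs, sq_abs]
  rw [this, sq]

lemma norm_sq_q (p : Quaternion ℝ) : ‖p‖ ^ 2 = p.re ^ 2 + p.imI ^ 2 + p.imJ ^ 2 + p.imK ^ 2 := by
  rw [sq, ← Quaternion.normSq_eq_norm_mul_self p, Quaternion.normSq_def']

lemma usph {I : Quaternion ℝ} (h : I ∈ USphere) :
    I.re = 0 ∧ I.imI ^ 2 + I.imJ ^ 2 + I.imK ^ 2 = 1 := by
  have h : I ^ 2 = -1 := h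
  have h0 : (I ^ 2).re = (-1 : Quaternion ℝ).re := by rw [h]
  have h1 : (I ^ 2).imI = (-1 : Quaternion ℝ).imI := by rw [h]
  have h2 : (I ^ 2).imJ = (-1 : Quaternion ℝ).imJ := by rw [h]
  have h3 : (I ^ 2).imK = (-1 : Quaternion ℝ).imK := by rw [h]
  rw [sq, Quaternion.re_mul, Quaternion.re_neg, Quaternion.re_one] at h0
  rw [sq, Quaternion.imI_mul, Quaternion.imI_neg, Quaternion.imI_one] at h1
  rw [sq, Quaternion.imJ_mul, Quaternion.imJ_neg, Quaternion.imJ_one] at h2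
  rw [sq, Quaternion.imK_mul, Quaternion.imK_neg, Quaternion.imK_one] at h3
  have hr : I.re = 0 := by
    by_contra hne
    have e1 : I.imI = 0 := by
      have : I.re * I.imI = 0 := by linarith
      exact (mul_eq_zero.mp this).resolve_left hne
    have e2 : I.imJ = 0 := by
      have : I.re * I.imJ = 0 := by linarith
      exact (mul_eq_zero.mp this).resolve_left hne
    have e3 : I.imK = 0 := by
      have : I.re * I.imK = 0 := by linarith
      exact (mul_eq_zero.mp this).resolve_left hne
    rw [e1, e2, e3] at h0
    nlinarith [sq_nonneg I.re]
  refine ⟨hr, ?_⟩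
  rw [hr] at h0
  nlinarith

lemma one_compC : (1 : QC) = mk4 1 0 0 0 := by
  ext
  · rw [Quaternion.re_one]; rfl
  · rw [Quaternion.imI_one]; rfl
  · rw [Quaternion.imJ_one]; rfl
  · rw [Quaternion.imK_one]; rfl

lemma one_compR : (1 : Quaternion ℝ) = mr4 1 0 0 0 := by
  ext
  · rw [Quaternion.re_one]; rfl
  · rw [Quaternion.imI_one]; rfl
  · rw [Quaternion.imJ_one]; rfl
  · rw [Quaternion.imK_one]; rfl

lemma usph_of {I : Quaternion ℝ} (h0 : I.re = 0) (h : I.imI ^ 2 + I.imJ ^ 2 + I.imK ^ 2 = 1) :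
    I ∈ USphere := by
  change I ^ 2 = -1
  rw [sq]
  ext
  · rw [Quaternion.re_mul, Quaternion.re_neg, Quaternion.re_one, h0]; linarith
  · rw [Quaternion.imI_mul, Quaternion.imI_neg, Quaternion.imI_one, h0]; ring
  · rw [Quaternion.imJ_mul, Quaternion.imJ_neg, Quaternion.imJ_one, h0]; ring
  · rw [Quaternion.imK_mul, Quaternion.imK_neg, Quaternion.imK_one, h0]; ring

lemma usph_mul {I : Quaternion ℝ} (h : I ∈ USphere) : I * I = -1 := by
  rw [← sq]; exact h

lemma usph_norm {I : Quaternion ℝ} (h : I ∈ USphere) : ‖I‖ = 1 := by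
  have := norm_sq_q I
  obtain ⟨h0, h1⟩ := usph h
  rw [h0] at this
  have h2 : ‖I‖ ^ 2 = 1 := by rw [this]; linarith
  nlinarith [norm_nonneg I]

/-- Slice embedding of the complex plane. -/
def phi (I : Quaternion ℝ) (z : ℂ) : Quaternion ℝ := (z.re : Quaternion ℝ) + z.im • I

lemma phi_add (I : Quaternion ℝ) (z w : ℂ) : phi I (z + w) = phi I z + phi I w := by
  unfold phi; simp [add_smul]; abel

lemma phi_mul {I : Quaternion ℝ} (h : I ∈ USphere) (z w : ℂ) :
    phi I (z * w) = phi I z * phi I w := by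
  obtain ⟨h0, h1⟩ := usph h
  unfold phi
  ext <;> simp [h0]
  · linear_combination (z.im * w.im) * h1
  all_goals ring

lemma phi_one (I : Quaternion ℝ) : phi I 1 = 1 := by unfold phi; simp

lemma phi_pow {I : Quaternion ℝ} (h : I ∈ USphere) (z : ℂ) (n : ℕ) :
    phi I (z ^ n) = phi I z ^ n := by
  induction n with
  | zero => simp [phi_one]
  | succ n ih => rw [pow_succ, pow_succ, phi_mul h, ih]

lemma phi_real (I : Quaternion ℝ) (x : ℝ) : phi I (x : ℂ) = (x : Quaternion ℝ) := by
  unfold phi; simp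

lemma phi_continuous (I : Quaternion ℝ) : Continuous (phi I) := by
  unfold phi
  have := Quaternion.continuous_coe
  fun_prop

/-- phi as an additive hom -/
def phiHom (I : Quaternion ℝ) : ℂ →+ Quaternion ℝ where
  toFun := phi I
  map_zero' := by unfold phi; simp
  map_add' := phi_add I

/-- Value of a stem on the slice of `I`. -/
def sl (I : Quaternion ℝ) (X : QC) : Quaternion ℝ :=
  phi I X.re + phi I X.imI * mr4 0 1 0 0 + phi I X.imJ * mr4 0 0 1 0 + phi I X.imK * mr4 0 0 0 1

lemma sl_eq (I : Quaternion ℝ) (X : QC) : sl I X = mr4 X.re.re X.imI.re X.imJ.re X.imK.re +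
    I * mr4 X.re.im X.imI.im X.imJ.im X.imK.im := by
  unfold sl phi
  ext <;> simp <;> ring

lemma sl_sc_up {I : Quaternion ℝ} (h : I ∈ USphere) (z : ℂ) (q : Quaternion ℝ) :
    sl I (sc z * up q) = phi I z * q := by
  rw [sc_mul]
  unfold sl up
  simp only [mk4_re, mk4_imI, mk4_imJ, mk4_imK, phi_mul h, phi_real]
  simp only [mul_assoc, ← mul_add]
  congr 1
  ext <;> simp

lemma norm_sl {I : Quaternion ℝ} (h : I ∈ USphere) (X : QC) :
    ‖sl I X‖ ^ 2 = (X * ad X).re.re - ((X * ad X).imI.im * I.imI + (X * ad X).imJ.im * I.imJ +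
      (X * ad X).imK.im * I.imK) := by
  have key : ∀ A B : Quaternion ℝ, ‖A + I * B‖ ^ 2 = ‖A‖ ^ 2 + ‖B‖ ^ 2 + 2 * (A * star (I * B)).re := by
    intro A B
    have h2 : ‖I * B‖ ^ 2 = ‖B‖ ^ 2 := by rw [norm_mul, usph_norm h, one_mul]
    rw [norm_sq_q A, ← h2, norm_sq_q (I * B), norm_sq_q]
    simp only [Quaternion.re_add, Quaternion.imI_add, Quaternion.imJ_add, Quaternion.imK_add,
      Quaternion.re_mul, Quaternion.re_star, Quaternion.imI_star, Quaternion.imJ_star,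
      Quaternion.imK_star]
    ring
  obtain ⟨h0, h1⟩ := usph h
  rw [sl_eq, key, norm_sq_q, norm_sq_q]
  unfold ad cj
  simp [h0]
  ring

/-- Idempotent. -/
def eI (I : Quaternion ℝ) : QC := sc (1 / 2) * (1 - sc Complex.I * up I)

lemma eI_mul {I : Quaternion ℝ} (h : I ∈ USphere) (X : QC) : eI I * X = eI I * up (sl I X) := by
  have hX : X = up (mr4 X.re.re X.imI.re X.imJ.re X.imK.re) +
      sc Complex.I * up (mr4 X.re.im X.imI.im X.imJ.im X.imK.im) := by
    rw [sc_mul]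
    unfold up
    ext <;> simp [mul_comm Complex.I]
  have hadd : ∀ p q : Quaternion ℝ, up (p + q) = up p + up q := by
    intro p q; unfold up; ext <;> simp
  rw [sl_eq, hadd, up_mul]
  conv_lhs => rw [hX]
  rw [mul_add, mul_add]
  congr 1
  rw [← mul_assoc, ← mul_assoc]
  congr 1
  have hII : up I * up I = sc (-1) := by
    rw [← up_mul, usph_mul h, one_compR]; unfold up sc; ext <;> simp
  have hcc : sc Complex.I * sc Complex.I = sc (-1) := by
    rw [sc_sc, Complex.I_mul_I]
  unfold eI
  rw [mul_assoc, mul_assoc]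
  congr 1
  rw [sub_mul, sub_mul, one_mul, one_mul, mul_assoc _ (up I) (up I), hII, mul_assoc, ← sc_comm, ← mul_assoc, hcc]
  unfold sc
  ext <;> simp <;> ring

lemma NN_eI {I : Quaternion ℝ} (h : I ∈ USphere) (q : Quaternion ℝ) :
    NN (eI I * up q) = ‖q‖ ^ 2 / 2 := by
  have hI : I * I = -1 := usph_mul h
  unfold eI
  have : (1 - sc Complex.I * up I) * up q = up q - sc Complex.I * up (I * q) := by
    rw [sub_mul, one_mul, mul_assoc, up_mul]
  rw [mul_assoc, NN_sc_mul, this]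
  have h2 : ∀ p r : Quaternion ℝ, NN (up p - sc Complex.I * up r) = ‖p‖ ^ 2 + ‖r‖ ^ 2 := by
    intro p r
    rw [sc_mul]
    unfold NN up
    rw [norm_sq_q, norm_sq_q]
    simp only [← Complex.normSq_eq_norm_sq, Complex.normSq_apply]
    simp
    ring
  rw [h2, norm_mul, usph_norm h]
  norm_num
  ring

end
end OuterProof

namespace OuterProof
open scoped ComplexConjugate
noncomputable section

/-- All four components satisfy `P`. -/
def C4 (P : (TT → ℂ) → Prop) (X : TT → QC) : Prop :=
  P (fun t => (X t).re) ∧ P (fun t => (X t).imI) ∧ P (fun t => (X t).imJ) ∧ P (fun t => (X t).imK)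

/-- Poisson extension. -/
def PoisQ (X : TT → QC) (z : ℂ) : QC :=
  mk4 (Pois (fun t => (X t).re) z) (Pois (fun t => (X t).imI) z) (Pois (fun t => (X t).imJ) z)
    (Pois (fun t => (X t).imK) z)

/-- Fourier coefficients. -/
def FQ (X : TT → QC) (n : ℤ) : QC :=
  mk4 (fourierCoeff (fun t => (X t).re) n) (fourierCoeff (fun t => (X t).imI) n)
    (fourierCoeff (fun t => (X t).imJ) n) (fourierCoeff (fun t => (X t).imK) n)

/-- square integrable -/
abbrev L2 : (TT → ℂ) → Prop := fun u => MemLp u 2 mT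
/-- bounded -/
abbrev LB : (TT → ℂ) → Prop := fun u => MemLp u ⊤ mT
/-- integrable -/
abbrev L1 : (TT → ℂ) → Prop := fun u => Integrable u mT

/-- `X` has Fourier coefficients `a`. -/
def Stem (a : ℤ → Quaternion ℝ) (X : TT → QC) : Prop := C4 L2 X ∧ ∀ n, FQ X n = up (a n)

/-- Extension by zero -/
def coefz (a : ℕ → Quaternion ℝ) (n : ℤ) : Quaternion ℝ := if 0 ≤ n then a n.toNat else 0

lemma coefz_nat (a : ℕ → Quaternion ℝ) (n : ℕ) : coefz a n = a n := by simp [coefz]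
lemma coefz_neg (a : ℕ → Quaternion ℝ) {n : ℤ} (h : n < 0) : coefz a n = 0 := by
  simp [coefz, not_le.mpr h]

lemma coefz_summable {a : ℕ → Quaternion ℝ} (h : MemH2 a) : Summable (fun n => ‖coefz a n‖ ^ 2) := by
  apply Summable.of_nat_of_neg_add_one
  · refine Summable.congr h (fun n => ?_); rw [coefz_nat]
  · refine Summable.congr summable_zero (fun n => ?_)
    rw [coefz_neg _ (by omega)]; simp

lemma FQ_iff {X : TT → QC} {n : ℤ} {q : Quaternion ℝ} (h : FQ X n = up q) :
    fourierCoeff (fun t => (X t).re) n = q.re ∧ fourierCoeff (fun t => (X t).imI) n = q.imI ∧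
    fourierCoeff (fun t => (X t).imJ) n = q.imJ ∧ fourierCoeff (fun t => (X t).imK) n = q.imK :=
  ⟨congrArg (fun Y : QC => Y.re) h, congrArg (fun Y : QC => Y.imI) h,
    congrArg (fun Y : QC => Y.imJ) h, congrArg (fun Y : QC => Y.imK) h⟩

lemma comp_le (q : Quaternion ℝ) : q.re ^ 2 ≤ ‖q‖ ^ 2 ∧ q.imI ^ 2 ≤ ‖q‖ ^ 2 ∧ q.imJ ^ 2 ≤ ‖q‖ ^ 2 ∧
    q.imK ^ 2 ≤ ‖q‖ ^ 2 := by
  rw [norm_sq_q]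
  refine ⟨?_, ?_, ?_, ?_⟩ <;>
  nlinarith [sq_nonneg q.re, sq_nonneg q.imI, sq_nonneg q.imJ, sq_nonneg q.imK]

lemma stem_exists (a : ℤ → Quaternion ℝ) (h : Summable (fun n => ‖a n‖ ^ 2)) :
    ∃ X, Stem a X := by
  have key : ∀ c : ℤ → ℝ, (∀ n, c n ^ 2 ≤ ‖a n‖ ^ 2) →
      ∃ u : TT → ℂ, MemLp u 2 mT ∧ ∀ n, fourierCoeff u n = c n := by
    intro c hc
    refine riesz_fischer (fun n => (c n : ℂ)) ?_
    refine Summable.of_nonneg_of_le (fun n => by positivity) (fun n => ?_) h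
    rw [Complex.norm_real, Real.norm_eq_abs, sq_abs]; exact hc n
  obtain ⟨u0, h0, e0⟩ := key (fun n => (a n).re) (fun n => (comp_le _).1)
  obtain ⟨u1, h1, e1⟩ := key (fun n => (a n).imI) (fun n => (comp_le _).2.1)
  obtain ⟨u2, h2, e2⟩ := key (fun n => (a n).imJ) (fun n => (comp_le _).2.2.1)
  obtain ⟨u3, h3, e3⟩ := key (fun n => (a n).imK) (fun n => (comp_le _).2.2.2)
  refine ⟨fun t => mk4 (u0 t) (u1 t) (u2 t) (u3 t), ⟨h0, h1, h2, h3⟩, fun n => ?_⟩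
  unfold FQ up
  simp only [mk4_re, mk4_imI, mk4_imJ, mk4_imK]
  rw [e0, e1, e2, e3]

lemma stem_A2 {a : ℤ → Quaternion ℝ} {X : TT → QC} (h : Stem a X) (h0 : ∀ n < 0, a n = 0) :
    C4 A2 X := by
  have := fun n => FQ_iff (h.2 n)
  refine ⟨⟨h.1.1, fun n hn => ?_⟩, ⟨h.1.2.1, fun n hn => ?_⟩, ⟨h.1.2.2.1, fun n hn => ?_⟩,
    ⟨h.1.2.2.2, fun n hn => ?_⟩⟩
  · rw [(this n).1, h0 n hn, Quaternion.re_zero, Complex.ofReal_zero]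
  · rw [(this n).2.1, h0 n hn, Quaternion.imI_zero, Complex.ofReal_zero]
  · rw [(this n).2.2.1, h0 n hn, Quaternion.imJ_zero, Complex.ofReal_zero]
  · rw [(this n).2.2.2, h0 n hn, Quaternion.imK_zero, Complex.ofReal_zero]

lemma C4.imp {P Q : (TT → ℂ) → Prop} {X : TT → QC} (h : C4 P X) (hPQ : ∀ u, P u → Q u) : C4 Q X :=
  ⟨hPQ _ h.1, hPQ _ h.2.1, hPQ _ h.2.2.1, hPQ _ h.2.2.2⟩

lemma stem_hasSum {a : ℕ → Quaternion ℝ} {X : TT → QC} (h : Stem (coefz a) X)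
    {I : Quaternion ℝ} (hI : I ∈ USphere) {z : ℂ} (hz : ‖z‖ < 1) :
    HasSum (fun n : ℕ => phi I z ^ n * a n) (sl I (PoisQ X z)) := by
  have hA := stem_A2 h (fun n hn => coefz_neg a hn)
  have hc := fun n : ℕ => FQ_iff (h.2 n)
  have key : ∀ u, A2 u → HasSum (fun n : ℕ => phi I (z ^ n * fourierCoeff u n)) (phi I (Pois u z)) := by
    intro u hu
    exact (Pois_hasSum_nat hz (memLp_integrable hu.1) hu.2).map (phiHom I) (phi_continuous I)
  have := ((key _ hA.1).add ((key _ hA.2.1).mul_right (mr4 0 1 0 0))).add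
    ((key _ hA.2.2.1).mul_right (mr4 0 0 1 0)) |>.add ((key _ hA.2.2.2).mul_right (mr4 0 0 0 1))
  refine hsc this (fun n => ?_) rfl
  have e := sl_sc_up hI (z ^ n) (a n)
  rw [← phi_pow hI, ← e, sc_mul]
  unfold sl
  simp only [mk4_re, mk4_imI, mk4_imJ, mk4_imK]
  rw [(hc n).1, (hc n).2.1, (hc n).2.2.1, (hc n).2.2.2, coefz_nat]
  rfl

lemma evalS_eq {a : ℕ → Quaternion ℝ} {X : TT → QC} (h : Stem (coefz a) X)
    {I : Quaternion ℝ} (hI : I ∈ USphere) {z : ℂ} (hz : ‖z‖ < 1) :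
    evalS a (phi I z) = sl I (PoisQ X z) := (stem_hasSum h hI hz).tsum_eq

lemma fourier_one_coe (x : ℝ) : (fourier 1 (x : TT) : ℂ) = Real.cos x + Real.sin x * Complex.I := by
  rw [fourier_coe_apply]
  have : (2 * Real.pi * Complex.I * (1 : ℤ) * x / ((2 * Real.pi : ℝ) : ℂ)) = x * Complex.I := by
    have := Real.pi_pos.ne'
    push_cast
    field_simp
  rw [this, Complex.exp_mul_I]; push_cast; rfl

lemma ptOn_eq (I : Quaternion ℝ) (x : ℝ) : ptOn I x = phi I (fourier 1 (x : TT)) := by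
  rw [fourier_one_coe]; unfold ptOn phi
  rw [Complex.add_re, Complex.add_im, Complex.re_ofReal_mul, Complex.im_ofReal_mul]
  simp only [Complex.ofReal_re, Complex.ofReal_im, Complex.I_re, Complex.I_im, mul_zero, mul_one,
    add_zero, zero_add]

lemma C4_integrable {X : TT → QC} (h : C4 L2 X) : C4 L1 X := h.imp (fun _ => memLp_integrable)

lemma bdval_eq {a : ℕ → Quaternion ℝ} {X : TT → QC} (h : Stem (coefz a) X) :
    ∀ᵐ t ∂mT, ∀ I ∈ USphere, ∀ x : ℝ, (x : TT) = t → bdval a (ptOn I x) = sl I (X t) := by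
  have hi := C4_integrable h.1
  filter_upwards [fatou hi.1, fatou hi.2.1, fatou hi.2.2.1, fatou hi.2.2.2] with t h0 h1 h2 h3 I hI x hx
  have hp : ∀ {u : TT → ℂ} {c : ℂ}, Tendsto (fun r : ℝ => Pois u (r * fourier 1 t)) (𝓝[<] 1) (𝓝 c) →
      Tendsto (fun r : ℝ => phi I (Pois u (r * fourier 1 t))) (𝓝[<] 1) (𝓝 (phi I c)) :=
    fun hu => ((phi_continuous I).tendsto _).comp hu
  have hl : Tendsto (fun r : ℝ => sl I (PoisQ X (r * fourier 1 t))) (𝓝[<] 1) (𝓝 (sl I (X t))) :=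
    (((hp h0).add ((hp h1).mul_const _)).add ((hp h2).mul_const _)).add ((hp h3).mul_const _)
  have hl2 : Tendsto (fun r : ℝ => evalS a ((r : Quaternion ℝ) * ptOn I x)) (𝓝[<] 1) (𝓝 (sl I (X t))) := by
    refine hl.congr' ?_
    filter_upwards [Ioo_mem_nhdsLT (show (0 : ℝ) < 1 by norm_num)] with r hr
    rw [ptOn_eq, hx, ← phi_real I, ← phi_mul hI, evalS_eq h hI]
    rw [norm_mul, norm_fourier, mul_one, Complex.norm_real, Real.norm_eq_abs, abs_of_pos hr.1]
    exact hr.2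
  have hex : ∃ L, Tendsto (fun r : ℝ => evalS a ((r : Quaternion ℝ) * ptOn I x)) (𝓝[<] 1) (𝓝 L) :=
    ⟨_, hl2⟩
  unfold bdval
  rw [dif_pos hex]
  exact tendsto_nhds_unique hex.choose_spec hl2

/-! ### products -/

lemma C4_mul {P Q R : (TT → ℂ) → Prop} (hm : ∀ u v, P u → Q v → R (fun t => u t * v t))
    (ha : ∀ u v, R u → R v → R (fun t => u t + v t)) (hs : ∀ u v, R u → R v → R (fun t => u t - v t))
    {X Y : TT → QC} (hX : C4 P X) (hY : C4 Q Y) : C4 R (fun t => X t * Y t) := by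
  obtain ⟨x0, x1, x2, x3⟩ := hX
  obtain ⟨y0, y1, y2, y3⟩ := hY
  refine ⟨?_, ?_, ?_, ?_⟩
  · simp only [Quaternion.re_mul]
    exact hs _ _ (hs _ _ (hs _ _ (hm _ _ x0 y0) (hm _ _ x1 y1)) (hm _ _ x2 y2)) (hm _ _ x3 y3)
  · simp only [Quaternion.imI_mul]
    exact hs _ _ (ha _ _ (ha _ _ (hm _ _ x0 y1) (hm _ _ x1 y0)) (hm _ _ x2 y3)) (hm _ _ x3 y2)
  · simp only [Quaternion.imJ_mul]
    exact ha _ _ (ha _ _ (hs _ _ (hm _ _ x0 y2) (hm _ _ x1 y3)) (hm _ _ x2 y0)) (hm _ _ x3 y1)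
  · simp only [Quaternion.imK_mul]
    exact ha _ _ (hs _ _ (ha _ _ (hm _ _ x0 y3) (hm _ _ x1 y2)) (hm _ _ x2 y1)) (hm _ _ x3 y0)

lemma C4_star {P : (TT → ℂ) → Prop} (hn : ∀ u, P u → P (fun t => - u t)) {X : TT → QC} (hX : C4 P X) :
    C4 P (fun t => star (X t)) := by
  refine ⟨?_, ?_, ?_, ?_⟩
  · simpa only [Quaternion.re_star] using hX.1
  · simpa only [Quaternion.imI_star] using hn _ hX.2.1
  · simpa only [Quaternion.imJ_star] using hn _ hX.2.2.1
  · simpa only [Quaternion.imK_star] using hn _ hX.2.2.2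

lemma C4_cj {P : (TT → ℂ) → Prop} (hn : ∀ u, P u → P (fun t => conj (u t))) {X : TT → QC} (hX : C4 P X) :
    C4 P (fun t => cj (X t)) :=
  ⟨hn _ hX.1, hn _ hX.2.1, hn _ hX.2.2.1, hn _ hX.2.2.2⟩

lemma memLp_ad {p : ℝ≥0∞} {X : TT → QC} (hX : C4 (fun u => MemLp u p mT) X) :
    C4 (fun u => MemLp u p mT) (fun t => ad (X t)) :=
  C4_star (fun _ h => h.neg) (C4_cj (fun _ h => h.star) hX)

lemma L2_mul {X Y : TT → QC} (hX : C4 L2 X) (hY : C4 L2 Y) : C4 L1 (fun t => X t * Y t) :=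
  C4_mul (fun _ _ hu hv => hu.integrable_mul hv) (fun _ _ hu hv => hu.add hv)
    (fun _ _ hu hv => hu.sub hv) hX hY

lemma LB_mul {X Y : TT → QC} (hX : C4 LB X) (hY : C4 L2 Y) : C4 L2 (fun t => X t * Y t) :=
  C4_mul (fun _ _ hu hv => hv.mul hu) (fun _ _ hu hv => hu.add hv)
    (fun _ _ hu hv => hu.sub hv) hX hY

lemma LB_LB {X Y : TT → QC} (hX : C4 LB X) (hY : C4 LB Y) : C4 LB (fun t => X t * Y t) :=
  C4_mul (fun _ _ hu hv => hv.mul hu) (fun _ _ hu hv => hu.add hv)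
    (fun _ _ hu hv => hu.sub hv) hX hY

lemma Pois_lin {z : ℂ} (hz : ‖z‖ < 1) (w : Fin 4 → TT → ℂ) (s : Fin 4 → ℂ) (hw : ∀ i, L1 (w i)) :
    Pois (fun t => ∑ i, s i * w i t) z = ∑ i, s i * Pois (w i) z := by
  unfold Pois
  have : ∀ t, (Pz z t : ℂ) * ∑ i, s i * w i t = ∑ i, s i * ((Pz z t : ℂ) * w i t) := by
    intro t; rw [Finset.mul_sum]; congr 1; funext i; ring
  simp only [this]
  rw [integral_finsetSum _ (fun i _ => (integrable_Pz_mul hz (hw i)).const_mul _)]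
  congr 1; funext i
  rw [integral_const_mul]

lemma fc_lin (w : Fin 4 → TT → ℂ) (s : Fin 4 → ℂ) (hw : ∀ i, L1 (w i)) (n : ℤ) :
    fourierCoeff (fun t => ∑ i, s i * w i t) n = ∑ i, s i * fourierCoeff (w i) n := by
  unfold fourierCoeff
  have : ∀ t, (fourier (-n) t : ℂ) • ∑ i, s i * w i t = ∑ i, s i * ((fourier (-n) t : ℂ) • w i t) := by
    intro t; rw [Finset.smul_sum]; congr 1; funext i; simp only [smul_eq_mul]; ring
  simp only [this]
  have hi : ∀ i, Integrable (fun t => (fourier (-n) t : ℂ) • w i t) mT := by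
    intro i
    refine Integrable.bdd_mul (c := 1) (hw _) ?_ ?_
    · exact (fourier (-n)).continuous.aestronglyMeasurable
    · exact Eventually.of_forall (fun t => (norm_fourier _ t).le)
  rw [integral_finsetSum _ (fun i _ => (hi i).const_mul _)]
  congr 1; funext i
  rw [integral_const_mul]

/-- sum of four signed products -/
lemma four (s : Fin 4 → ℂ) (a b : Fin 4 → ℂ) : ∑ i, s i * (a i * b i) =
    s 0 * (a 0 * b 0) + s 1 * (a 1 * b 1) + s 2 * (a 2 * b 2) + s 3 * (a 3 * b 3) :=
  Fin.sum_univ_four _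

lemma Pois_four {z : ℂ} (hz : ‖z‖ < 1) (s : Fin 4 → ℂ) {a0 a1 a2 a3 b0 b1 b2 b3 : TT → ℂ}
    (p0 : A2 a0) (p1 : A2 a1) (p2 : A2 a2) (p3 : A2 a3)
    (q0 : A2 b0) (q1 : A2 b1) (q2 : A2 b2) (q3 : A2 b3) :
    Pois (fun t => s 0 * (a0 t * b0 t) + s 1 * (a1 t * b1 t) + s 2 * (a2 t * b2 t) + s 3 * (a3 t * b3 t)) z
      = s 0 * (Pois a0 z * Pois b0 z) + s 1 * (Pois a1 z * Pois b1 z) + s 2 * (Pois a2 z * Pois b2 z)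
        + s 3 * (Pois a3 z * Pois b3 z) := by
  have h := Pois_lin hz ![fun t => a0 t * b0 t, fun t => a1 t * b1 t, fun t => a2 t * b2 t,
    fun t => a3 t * b3 t] s (by
      intro i; fin_cases i
      · exact p0.1.integrable_mul q0.1
      · exact p1.1.integrable_mul q1.1
      · exact p2.1.integrable_mul q2.1
      · exact p3.1.integrable_mul q3.1)
  simp only [Fin.sum_univ_four] at h
  refine h.trans ?_
  rw [← Pois_mul hz p0 q0, ← Pois_mul hz p1 q1, ← Pois_mul hz p2 q2, ← Pois_mul hz p3 q3]
  rfl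

lemma PoisQ_mul {z : ℂ} (hz : ‖z‖ < 1) {X Y : TT → QC} (hX : C4 A2 X) (hY : C4 A2 Y) :
    PoisQ (fun t => X t * Y t) z = PoisQ X z * PoisQ Y z := by
  obtain ⟨x0, x1, x2, x3⟩ := hX
  obtain ⟨y0, y1, y2, y3⟩ := hY
  unfold PoisQ
  ext
  · have h := Pois_four hz ![1, -1, -1, -1] x0 x1 x2 x3 y0 y1 y2 y3
    simp at h
    simp only [Quaternion.re_mul, mk4_re, mk4_imI, mk4_imJ, mk4_imK]
    simp only [sub_eq_add_neg]
    exact h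
  · have h := Pois_four hz ![1, 1, 1, -1] x0 x1 x2 x3 y1 y0 y3 y2
    simp at h
    simp only [Quaternion.imI_mul, mk4_re, mk4_imI, mk4_imJ, mk4_imK]
    simp only [sub_eq_add_neg]
    exact h
  · have h := Pois_four hz ![1, -1, 1, 1] x0 x1 x2 x3 y2 y3 y0 y1
    simp at h
    simp only [Quaternion.imJ_mul, mk4_re, mk4_imI, mk4_imJ, mk4_imK]
    simp only [sub_eq_add_neg]
    exact h
  · have h := Pois_four hz ![1, 1, -1, 1] x0 x1 x2 x3 y3 y2 y1 y0
    simp at h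
    simp only [Quaternion.imK_mul, mk4_re, mk4_imI, mk4_imJ, mk4_imK]
    simp only [sub_eq_add_neg]
    exact h

lemma A2_LB_mul {X Y : TT → QC} (hX : C4 LB X) (hX2 : C4 A2 X) (hY : C4 A2 Y) :
    C4 A2 (fun t => X t * Y t) :=  by
  have h1 := LB_mul hX (hY.imp (fun _ h => h.1))
  have h2 : C4 (fun u => Integrable u mT ∧ ∀ n : ℤ, n < 0 → fourierCoeff u n = 0) (fun t => X t * Y t) := by
    refine C4_mul (fun u v hu hv => ⟨hu.1.integrable_mul hv.1, A2_mul_coeff_neg hu hv⟩) ?_ ?_ hX2 hY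
    · intro u v hu hv
      refine ⟨hu.1.add hv.1, fun n hn => ?_⟩
      have := fc_lin ![u, v, 0, 0] ![1, 1, 0, 0] (by
        intro i; fin_cases i
        · exact hu.1
        · exact hv.1
        · exact integrable_zero _ _ _
        · exact integrable_zero _ _ _) n
      simp [Fin.sum_univ_four, hu.2 n hn, hv.2 n hn] at this
      exact this
    · intro u v hu hv
      refine ⟨hu.1.sub hv.1, fun n hn => ?_⟩
      have := fc_lin ![u, v, 0, 0] ![1, -1, 0, 0] (by
        intro i; fin_cases i
        · exact hu.1
        · exact hv.1
        · exact integrable_zero _ _ _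
        · exact integrable_zero _ _ _) n
      simp [Fin.sum_univ_four, hu.2 n hn, hv.2 n hn] at this
      simpa only [sub_eq_add_neg] using this
  exact ⟨⟨h1.1, h2.1.2⟩, ⟨h1.2.1, h2.2.1.2⟩, ⟨h1.2.2.1, h2.2.2.1.2⟩, ⟨h1.2.2.2, h2.2.2.2.2⟩⟩

lemma A2_star {X : TT → QC} (hX : C4 A2 X) : C4 A2 (fun t => star (X t)) := by
  refine C4_star ?_ hX
  intro u hu
  refine ⟨hu.1.neg, fun n hn => ?_⟩
  have := fc_lin ![u, 0, 0, 0] ![-1, 0, 0, 0] (by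
        intro i; fin_cases i
        · exact memLp_integrable hu.1
        · exact integrable_zero _ _ _
        · exact integrable_zero _ _ _
        · exact integrable_zero _ _ _) n
  simp [Fin.sum_univ_four, hu.2 n hn] at this
  exact this

end
end OuterProof

namespace OuterProof
open scoped ComplexConjugate
noncomputable section

instance : SecondCountableTopology (Quaternion ℝ) :=
  haveI : ProperSpace (Quaternion ℝ) := FiniteDimensional.proper ℝ _
  inferInstance

lemma ptOn_cont : Continuous (fun p : ℝ × Quaternion ℝ => ptOn p.2 p.1) := by
  unfold ptOn
  have := Quaternion.continuous_coe
  fun_prop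

lemma usph_closed : IsClosed USphere := by
  unfold USphere
  exact isClosed_eq (by fun_prop) continuous_const

lemma sph_cases : sphMeasure = 0 ∨ IsProbabilityMeasure sphMeasure := by
  by_cases h0 : μH[2] USphere = 0
  · left
    unfold sphMeasure
    rw [Measure.restrict_eq_zero.mpr h0, smul_zero]
  by_cases h1 : μH[2] USphere = ⊤
  · left
    unfold sphMeasure
    rw [h1]; simp
  · right
    constructor
    unfold sphMeasure
    simp [ENNReal.inv_mul_cancel h0 h1]

lemma constS_mem (c : Quaternion ℝ) : MemH2 (constS c) := by
  unfold MemH2 constS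
  refine summable_of_ne_finset_zero (s := {0}) ?_
  intro n hn
  have : n ≠ 0 := by simpa using hn
  simp [this]

lemma evalS_zero (a : ℕ → Quaternion ℝ) : evalS a 0 = a 0 := by
  unfold evalS
  rw [tsum_eq_single 0]
  · simp
  · intro n hn; simp [hn]

lemma not_outer_of_zero (h : sphMeasure = 0) (f : ℕ → Quaternion ℝ) : ¬ IsOuterQ f := by
  rintro ⟨h1, h2⟩
  have hs : SigmaBd = 0 := by
    unfold SigmaBd; rw [h]; simp
  have := h2 (constS ((‖f 0‖ + 1 : ℝ) : Quaternion ℝ)) (constS_mem _) (by rw [hs]; simp) 0 (by simp [QBall])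
  rw [evalS_zero, evalS_zero] at this
  simp only [constS, if_true, Quaternion.norm_coe, Real.norm_eq_abs] at this
  rw [abs_of_nonneg (by positivity)] at this
  linarith

lemma ae_usph : ∀ᵐ I ∂sphMeasure, I ∈ USphere := by
  unfold sphMeasure
  exact Measure.ae_smul_measure (ae_restrict_mem usph_closed.measurableSet) _

lemma exists_unit (q : Quaternion ℝ) (h : ‖q‖ = 1) :
    ∃ I ∈ USphere, q = ptOn I (Real.arccos q.re) := by
  have hn := norm_sq_q q
  rw [h] at hn
  have hb : q.re ^ 2 ≤ 1 := by nlinarith [sq_nonneg q.imI, sq_nonneg q.imJ, sq_nonneg q.imK]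
  have hc : Real.cos (Real.arccos q.re) = q.re :=
    Real.cos_arccos (by nlinarith) (by nlinarith)
  set s := Real.sin (Real.arccos q.re) with hs
  have hss : s ^ 2 = 1 - q.re ^ 2 := by
    rw [hs, Real.sin_sq, hc]
  have him : q.imI ^ 2 + q.imJ ^ 2 + q.imK ^ 2 = s ^ 2 := by linarith
  by_cases h0 : s = 0
  · refine ⟨mr4 0 1 0 0, usph_of rfl (by simp), ?_⟩
    unfold ptOn
    rw [hc, ← hs, h0]
    rw [h0] at him
    have a1 : q.imI = 0 := by nlinarith [sq_nonneg q.imI, sq_nonneg q.imJ, sq_nonneg q.imK]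
    have a2 : q.imJ = 0 := by nlinarith [sq_nonneg q.imI, sq_nonneg q.imJ, sq_nonneg q.imK]
    have a3 : q.imK = 0 := by nlinarith [sq_nonneg q.imI, sq_nonneg q.imJ, sq_nonneg q.imK]
    ext <;> simp [a1, a2, a3]
  · refine ⟨mr4 0 (q.imI / s) (q.imJ / s) (q.imK / s), usph_of rfl ?_, ?_⟩
    · simp only [mr4_imI, mr4_imJ, mr4_imK]
      field_simp
      linarith
    · unfold ptOn
      rw [hc, ← hs]
      ext <;> simp <;> field_simp

lemma coe_ae {p : TT → Prop} (h : ∀ᵐ t ∂mT, p t) : ∀ᵐ x : ℝ, p (x : TT) := by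
  rw [ae_mT_iff] at h
  have key : ∀ n : ℤ, ∀ᵐ x : ℝ ∂(volume.restrict (Set.Ioc (2 * Real.pi * n) (2 * Real.pi * n + 2 * Real.pi))),
      p (x : TT) := fun n =>
    (AddCircle.measurePreserving_mk (2 * Real.pi) (2 * Real.pi * n)).quasiMeasurePreserving.ae h
  have h2 := ae_all_iff.mpr (fun n : ℤ => (ae_restrict_iff' measurableSet_Ioc).mp (key n))
  filter_upwards [h2] with x hx
  obtain ⟨n, hn, -⟩ := existsUnique_add_zsmul_mem_Ioc Real.two_pi_pos x 0
  refine hx (-n) ?_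
  simp only [zsmul_eq_mul] at hn
  push_cast
  constructor <;> [have := hn.1; have := hn.2] <;> linarith

lemma ae_Sigma_of [IsProbabilityMeasure sphMeasure] {p : Quaternion ℝ → Prop}
    (h : ∀ᵐ t ∂mT, ∀ I ∈ USphere, ∀ x : ℝ, (x : TT) = t → p (ptOn I x)) : ∀ᵐ q ∂SigmaBd, p q := by
  have h1 := coe_ae h
  set B : Set ℝ := {x | ¬ ∀ I ∈ USphere, ∀ y : ℝ, (y : TT) = (x : TT) → p (ptOn I y)} with hB
  have hB0 : volume B = 0 := h1
  set B' := toMeasurable volume B with hB'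
  have hB'0 : volume B' = 0 := by rw [hB', measure_toMeasurable]; exact hB0
  have hB'm : MeasurableSet B' := measurableSet_toMeasurable _ _
  set M : Set (Quaternion ℝ) := {q | ‖q‖ = 1 ∧ Real.arccos q.re ∉ B'} with hM
  have hMm : MeasurableSet M := by
    apply MeasurableSet.inter
    · exact (isClosed_eq continuous_norm continuous_const).measurableSet
    · have : Measurable (fun q : Quaternion ℝ => Real.arccos q.re) :=
        (Real.continuous_arccos.comp Quaternion.continuous_re).measurable
      exact (this hB'm).compl
  have hMp : ∀ q ∈ M, p q := by
    rintro q ⟨hq, hq2⟩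
    obtain ⟨I, hI, hqI⟩ := exists_unit q hq
    have : Real.arccos q.re ∉ B := fun hh => hq2 (subset_toMeasurable _ _ hh)
    simp only [hB, Set.mem_ofPred_eq, not_not] at this
    rw [hqI]
    exact this I hI _ rfl
  have hMae : ∀ᵐ q ∂SigmaBd, q ∈ M := by
    unfold SigmaBd
    refine Measure.ae_smul_measure ?_ _
    refine (ae_map_iff (p := fun q => q ∈ M) ptOn_cont.measurable.aemeasurable hMm).mpr ?_
    have n1 : ∀ᵐ x : ℝ, x ∉ B' := measure_eq_zero_iff_ae_notMem.mp hB'0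
    have n2 : ∀ᵐ x : ℝ, 2 * Real.pi - x ∉ B' :=
      (Measure.measurePreserving_sub_left volume (2 * Real.pi)).quasiMeasurePreserving.ae n1
    have n3 : ∀ᵐ x : ℝ ∂(volume.restrict (Set.Ico 0 (2 * Real.pi))),
        x ∉ B' ∧ 2 * Real.pi - x ∉ B' ∧ x ∈ Set.Ico 0 (2 * Real.pi) := by
      filter_upwards [ae_restrict_of_ae n1, ae_restrict_of_ae n2, ae_restrict_mem measurableSet_Ico]
        with x a b c using ⟨a, b, c⟩
    filter_upwards [Measure.quasiMeasurePreserving_fst.ae n3,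
      Measure.quasiMeasurePreserving_snd.ae ae_usph] with q hq1 hq2
    obtain ⟨x, I⟩ := q
    obtain ⟨a, b, c⟩ := hq1
    have hr := (usph hq2).1
    have hre : (ptOn I x).re = Real.cos x := by
      unfold ptOn; simp only [Quaternion.re_add, Quaternion.re_coe, Quaternion.re_smul]
      rw [hr]; simp
    refine ⟨?_, ?_⟩
    · have h2 : ‖ptOn I x‖ ^ 2 = 1 := by
        rw [norm_sq_q, hre]
        have i1 : (ptOn I x).imI = Real.sin x * I.imI := by unfold ptOn; simp
        have i2 : (ptOn I x).imJ = Real.sin x * I.imJ := by unfold ptOn; simp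
        have i3 : (ptOn I x).imK = Real.sin x * I.imK := by unfold ptOn; simp
        rw [i1, i2, i3]
        have := (usph hq2).2
        have hsc := Real.sin_sq_add_cos_sq x
        linear_combination (Real.sin x ^ 2) * this + hsc
      change ‖ptOn I x‖ = 1
      nlinarith [norm_nonneg (ptOn I x)]
    · change Real.arccos (ptOn I x).re ∉ B'
      rw [hre]
      by_cases hx : x ≤ Real.pi
      · rw [Real.arccos_cos c.1 hx]; exact a
      · have : Real.cos x = Real.cos (2 * Real.pi - x) := by rw [Real.cos_two_pi_sub]
        rw [this, Real.arccos_cos (by linarith [c.2]) (by linarith)]; exact b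
  filter_upwards [hMae] with q hq using hMp q hq

lemma ae_of_Sigma [IsProbabilityMeasure sphMeasure] {p : Quaternion ℝ → Prop}
    (h : ∀ᵐ q ∂SigmaBd, p q) :
    ∀ᵐ t ∂mT, ∃ x : ℝ, (x : TT) = t ∧ ∀ᵐ I ∂sphMeasure, p (ptOn I x) := by
  unfold SigmaBd at h
  rw [Measure.ae_ennreal_smul_measure_iff (ENNReal.inv_ne_zero.mpr ENNReal.ofReal_ne_top)] at h
  have h2 := Measure.ae_ae_of_ae_prod (ae_of_ae_map ptOn_cont.measurable.aemeasurable h)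
  rw [ae_restrict_iff' measurableSet_Ico] at h2
  set B : Set ℝ := {x | ¬ (x ∈ Set.Ico 0 (2 * Real.pi) → ∀ᵐ I ∂sphMeasure, p (ptOn I x))} with hB
  have hB0 : volume B = 0 := h2
  set B' := toMeasurable volume B with hB'
  have hB'0 : volume B' = 0 := by rw [hB', measure_toMeasurable]; exact hB0
  have hB'm : MeasurableSet B' := measurableSet_toMeasurable _ _
  let e := AddCircle.measurableEquivIco (2 * Real.pi) 0
  have hm : MeasurableSet {t : TT | ((e t : ℝ)) ∈ B'} :=
    (measurable_subtype_coe.comp e.measurable) hB'm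
  have hnull : ∀ᵐ t : TT, (e t : ℝ) ∉ B' := by
    have hmp := AddCircle.measurePreserving_mk (2 * Real.pi) 0
    rw [← hmp.map_eq]
    refine (ae_map_iff (p := fun t => (e t : ℝ) ∉ B') hmp.measurable.aemeasurable hm.compl).mpr ?_
    have n1 : ∀ᵐ x : ℝ, x ∉ B' := measure_eq_zero_iff_ae_notMem.mp hB'0
    have n2 : ∀ᵐ x : ℝ, x ≠ 2 * Real.pi := by simp [ae_iff]
    filter_upwards [ae_restrict_of_ae n1, ae_restrict_of_ae n2, ae_restrict_mem measurableSet_Ioc] with x a b c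
    have hx : x ∈ Set.Ico (0 : ℝ) (0 + 2 * Real.pi) := ⟨c.1.le, lt_of_le_of_ne c.2 (by simpa using b)⟩
    have : (e (x : TT) : ℝ) = x := by
      have := AddCircle.equivIco_coe_of_mem hx
      exact this
    rw [this]; exact a
  rw [ae_mT_iff]
  filter_upwards [hnull] with t ht
  have hin : ((e t : ℝ)) ∈ Set.Ico (0 : ℝ) (0 + 2 * Real.pi) := (e t).2
  refine ⟨e t, AddCircle.coe_equivIco, ?_⟩
  have : (e t : ℝ) ∉ B := fun hh => ht (subset_toMeasurable _ _ hh)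
  simp only [hB, Set.mem_ofPred_eq, not_not] at this
  exact this (by simpa using hin)

/-! ### rotations -/

lemma sph_iso (T : Quaternion ℝ → Quaternion ℝ) (hi : Isometry T) (hinv : Function.Involutive T)
    (hU : ∀ I ∈ USphere, T I ∈ USphere) {p : Quaternion ℝ → Prop} (h : ∀ᵐ I ∂sphMeasure, p I) :
    ∀ᵐ I ∂sphMeasure, p (T I) := by
  let e : Quaternion ℝ ≃ᵢ Quaternion ℝ := ⟨hinv.toPerm T, hi⟩
  have hmp : MeasurePreserving T (μH[2] : Measure (Quaternion ℝ)) μH[2] :=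
    e.measurePreserving_hausdorffMeasure 2
  by_cases hz : (μH[2] USphere)⁻¹ = 0
  · unfold sphMeasure; rw [hz, zero_smul]; simp
  unfold sphMeasure at h ⊢
  rw [Measure.ae_ennreal_smul_measure_iff hz, ae_restrict_iff' usph_closed.measurableSet] at *
  filter_upwards [hmp.quasiMeasurePreserving.ae h] with I hI hI2 using hI (hU I hI2)

lemma iso_of (T : Quaternion ℝ → Quaternion ℝ) (hs : ∀ a b, T (a - b) = T a - T b)
    (hn : ∀ a, ‖T a‖ ^ 2 = ‖a‖ ^ 2) : Isometry T := by
  refine Isometry.of_dist_eq (fun a b => ?_)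
  rw [dist_eq_norm, dist_eq_norm, ← hs]
  exact (sq_eq_sq₀ (norm_nonneg _) (norm_nonneg _)).mp (hn _)

/-- affine functional vanishing almost everywhere -/
def QV (c v1 v2 v3 : ℝ) : Prop :=
  ∀ᵐ I ∂sphMeasure, c + v1 * I.imI + v2 * I.imJ + v3 * I.imK = 0

lemma QV_flip {c v1 v2 v3 : ℝ} (h : QV c v1 v2 v3) : QV c (-v1) v2 v3 := by
  have := sph_iso (fun q => mr4 q.re (-q.imI) q.imJ q.imK) (iso_of _ (fun a b => by
      ext <;> simp <;> ring) (fun a => by simp [norm_sq_q]))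
    (fun a => by ext <;> simp) (fun I hI => by
      obtain ⟨h0, h1⟩ := usph hI
      exact usph_of (by simpa using h0) (by simpa using h1)) h
  unfold QV
  filter_upwards [this] with I hI
  simp only [mr4_imI, mr4_imJ, mr4_imK] at hI
  linarith

lemma QV_swap {c v1 v2 v3 : ℝ} (h : QV c v1 v2 v3) : QV c v2 v1 v3 := by
  have := sph_iso (fun q => mr4 q.re q.imJ q.imI q.imK) (iso_of _ (fun a b => by
      ext <;> simp) (fun a => by simp [norm_sq_q]; ring))
    (fun a => by ext <;> simp) (fun I hI => by
      obtain ⟨h0, h1⟩ := usph hI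
      exact usph_of (by simpa using h0) (by simp only [mr4_imI, mr4_imJ, mr4_imK]; linarith)) h
  unfold QV
  filter_upwards [this] with I hI
  simp only [mr4_imI, mr4_imJ, mr4_imK] at hI
  linarith

lemma QV_swap' {c v1 v2 v3 : ℝ} (h : QV c v1 v2 v3) : QV c v1 v3 v2 := by
  have := sph_iso (fun q => mr4 q.re q.imI q.imK q.imJ) (iso_of _ (fun a b => by
      ext <;> simp) (fun a => by simp [norm_sq_q]; ring))
    (fun a => by ext <;> simp) (fun I hI => by
      obtain ⟨h0, h1⟩ := usph hI
      exact usph_of (by simpa using h0) (by simp only [mr4_imI, mr4_imJ, mr4_imK]; linarith)) h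
  unfold QV
  filter_upwards [this] with I hI
  simp only [mr4_imI, mr4_imJ, mr4_imK] at hI
  linarith

lemma QV_one [IsProbabilityMeasure sphMeasure] {c v1 v2 v3 : ℝ} (h : QV c v1 v2 v3) : v1 = 0 := by
  have h1 : QV 0 v1 0 0 := by
    have h2 := QV_flip h
    unfold QV at *
    filter_upwards [h, h2] with I a b
    linarith
  have h2 : QV 0 0 v1 0 := QV_swap h1
  have h3 : QV 0 0 0 v1 := QV_swap' h2
  unfold QV at *
  obtain ⟨I, ⟨⟨a, b⟩, c⟩, d⟩ := (((h1.and h2).and h3).and ae_usph).exists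
  have := (usph d).2
  simp only [zero_mul, zero_add, add_zero] at a b c
  have : v1 * v1 = (v1 * I.imI) ^ 2 + (v1 * I.imJ) ^ 2 + (v1 * I.imK) ^ 2 := by
    linear_combination (-v1 ^ 2) * this
  rw [a, b, c] at this
  exact mul_self_eq_zero.mp (by simpa using this)

lemma QV_all [IsProbabilityMeasure sphMeasure] {c v1 v2 v3 : ℝ} (h : QV c v1 v2 v3) :
    c = 0 ∧ v1 = 0 ∧ v2 = 0 ∧ v3 = 0 := by
  have e1 := QV_one h
  have e2 := QV_one (QV_swap h)
  have e3 := QV_one (QV_swap (QV_swap' h))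
  refine ⟨?_, e1, e2, e3⟩
  unfold QV at h
  obtain ⟨I, hI⟩ := h.exists
  rw [e1, e2, e3] at hI
  simpa using hI

lemma herm_comp (X : QC) : (X * ad X).re.im = 0 ∧ (X * ad X).imI.re = 0 ∧ (X * ad X).imJ.re = 0 ∧
    (X * ad X).imK.re = 0 := by
  unfold ad cj
  refine ⟨?_, ?_, ?_, ?_⟩ <;> simp <;> ring

lemma herm_eq [IsProbabilityMeasure sphMeasure] {X Y : QC}
    (h : ∀ᵐ I ∂sphMeasure, ‖sl I X‖ = ‖sl I Y‖) : X * ad X = Y * ad Y := by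
  have hq : QV ((X * ad X).re.re - (Y * ad Y).re.re) ((Y * ad Y).imI.im - (X * ad X).imI.im)
      ((Y * ad Y).imJ.im - (X * ad X).imJ.im) ((Y * ad Y).imK.im - (X * ad X).imK.im) := by
    unfold QV
    filter_upwards [h, ae_usph] with I hI hU
    have h1 := norm_sl hU X
    have h2 := norm_sl hU Y
    rw [hI, h2] at h1
    linarith
  obtain ⟨a, b, c, d⟩ := QV_all hq
  obtain ⟨x0, x1, x2, x3⟩ := herm_comp X
  obtain ⟨y0, y1, y2, y3⟩ := herm_comp Y
  ext <;> apply Complex.ext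
  · linarith
  · rw [x0, y0]
  · rw [x1, y1]
  · linarith
  · rw [x2, y2]
  · linarith
  · rw [x3, y3]
  · linarith

lemma norm_sl_congr {X Y : QC} (h : X * ad X = Y * ad Y) {I : Quaternion ℝ} (hI : I ∈ USphere) :
    ‖sl I X‖ = ‖sl I Y‖ := by
  have h1 := norm_sl hI X
  rw [h, ← norm_sl hI Y] at h1
  exact (sq_eq_sq₀ (norm_nonneg _) (norm_nonneg _)).mp h1

end
end OuterProof

namespace OuterProof
open scoped ComplexConjugate
noncomputable section

/-- Euclidean model. -/
def toE (X : QC) : EuclideanSpace ℂ (Fin 4) := WithLp.toLp 2 ![X.re, X.imI, X.imJ, X.imK]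

lemma toE_norm (X : QC) : ‖toE X‖ ^ 2 = NN X := by
  rw [EuclideanSpace.norm_sq_eq, Fin.sum_univ_four]
  rfl

lemma vec_bound {z : ℂ} (hz : ‖z‖ < 1) {V : TT → QC} (hV : C4 L1 V) {m : TT → ℝ}
    (hm : Integrable (fun t => Pz z t * m t) mT) (hm0 : ∀ t, 0 ≤ m t)
    (hVm : ∀ᵐ t ∂mT, NN (V t) ≤ m t ^ 2) :
    NN (PoisQ V z) ≤ (∫ t, Pz z t * m t ∂mT) ^ 2 := by
  have hitg : Integrable (fun t => toE (sc (Pz z t) * V t)) mT := by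
    rw [← PiLp.continuousLinearEquiv 2 ℂ (fun _ : Fin 4 => ℂ) |>.integrable_comp_iff]
    rw [integrable_pi_iff]
    intro i
    fin_cases i
    · exact (integrable_Pz_mul hz hV.1).congr (Eventually.of_forall fun t => by
        simp [toE, sc_mul])
    · exact (integrable_Pz_mul hz hV.2.1).congr (Eventually.of_forall fun t => by
        simp [toE, sc_mul])
    · exact (integrable_Pz_mul hz hV.2.2.1).congr (Eventually.of_forall fun t => by
        simp [toE, sc_mul])
    · exact (integrable_Pz_mul hz hV.2.2.2).congr (Eventually.of_forall fun t => by
        simp [toE, sc_mul])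
  have heq : ∫ t, toE (sc (Pz z t) * V t) ∂mT = toE (PoisQ V z) := by
    ext i
    have h1 := (EuclideanSpace.proj i : EuclideanSpace ℂ (Fin 4) →L[ℂ] ℂ).integral_comp_comm hitg
    refine (h1.symm).trans ?_
    fin_cases i
    · simp [toE, sc_mul, PoisQ, Pois]
    · simp [toE, sc_mul, PoisQ, Pois]
    · simp [toE, sc_mul, PoisQ, Pois]
    · simp [toE, sc_mul, PoisQ, Pois]
  rw [← toE_norm, ← heq]
  refine pow_le_pow_left₀ (norm_nonneg _) ?_ 2
  refine norm_integral_le_of_norm_le hm ?_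
  filter_upwards [hVm] with t ht
  have hp := Pz_nonneg hz t
  refine abs_le_of_sq_le_sq' ?_ (mul_nonneg hp (hm0 t)) |>.2
  rw [toE_norm, NN_sc_mul, Complex.norm_real, Real.norm_eq_abs, sq_abs, mul_pow]
  gcongr

lemma fc_const (c : ℂ) {n : ℤ} (hn : n ≠ 0) : fourierCoeff (fun _ : TT => c) n = 0 := by
  have := congrFun (fourierCoeff_fourier (T := 2 * Real.pi) 0) n
  simp only [Pi.single_apply, if_neg hn] at this
  have h2 := fourierCoeff.const_smul (fourier 0 : TT → ℂ) c n
  rw [this, smul_zero] at h2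
  rw [← h2]
  congr 1; funext t; simp

lemma A2_const (c : ℂ) : A2 (fun _ => c) := ⟨memLp_const c, fun _ hn => fc_const c hn.ne⟩

lemma Pois_const {z : ℂ} (hz : ‖z‖ < 1) (c : ℂ) : Pois (fun _ => c) z = c := by
  have h := Pz_integral_one hz
  unfold Pois at *
  rw [integral_mul_const]
  simp only [mul_one] at h
  rw [h, one_mul]

lemma C4_const {P : (TT → ℂ) → Prop} (h : ∀ c, P (fun _ => c)) (A : QC) : C4 P (fun _ => A) :=
  ⟨h _, h _, h _, h _⟩

lemma PoisQ_const {z : ℂ} (hz : ‖z‖ < 1) (A : QC) : PoisQ (fun _ => A) z = A := by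
  unfold PoisQ
  simp only [Pois_const hz]
  rfl

lemma Pois_congr {u v : TT → ℂ} (h : ∀ᵐ t ∂mT, u t = v t) (z : ℂ) : Pois u z = Pois v z := by
  unfold Pois
  refine integral_congr_ae ?_
  filter_upwards [h] with t ht
  rw [ht]

lemma PoisQ_congr {X Y : TT → QC} (h : ∀ᵐ t ∂mT, X t = Y t) (z : ℂ) : PoisQ X z = PoisQ Y z := by
  unfold PoisQ
  have e0 : Pois (fun t => (X t).re) z = Pois (fun t => (Y t).re) z :=
    Pois_congr (h.mono fun t ht => congrArg (fun q : QC => q.re) ht) z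
  have e1 : Pois (fun t => (X t).imI) z = Pois (fun t => (Y t).imI) z :=
    Pois_congr (h.mono fun t ht => congrArg (fun q : QC => q.imI) ht) z
  have e2 : Pois (fun t => (X t).imJ) z = Pois (fun t => (Y t).imJ) z :=
    Pois_congr (h.mono fun t ht => congrArg (fun q : QC => q.imJ) ht) z
  have e3 : Pois (fun t => (X t).imK) z = Pois (fun t => (Y t).imK) z :=
    Pois_congr (h.mono fun t ht => congrArg (fun q : QC => q.imK) ht) z
  rw [e0, e1, e2, e3]

lemma Pois_neg (u : TT → ℂ) (z : ℂ) : Pois (fun t => - u t) z = - Pois u z := by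
  unfold Pois
  rw [← integral_neg]
  congr 1; funext t; ring

lemma PoisQ_star (X : TT → QC) (z : ℂ) : PoisQ (fun t => star (X t)) z = star (PoisQ X z) := by
  unfold PoisQ
  ext
  · simp only [Quaternion.re_star, mk4_re]
  · simp only [Quaternion.imI_star, mk4_imI, Pois_neg]
  · simp only [Quaternion.imJ_star, mk4_imJ, Pois_neg]
  · simp only [Quaternion.imK_star, mk4_imK, Pois_neg]

lemma real_int_Pz {z : ℂ} (hz : ‖z‖ < 1) {m : TT → ℝ} (hm : Integrable m mT) :
    Integrable (fun t => Pz z t * m t) mT := by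
  refine Integrable.bdd_mul (c := ∑' n : ℤ, ‖pk z n‖) hm ?_ ?_
  · exact (Pz_continuous hz).aestronglyMeasurable
  · refine Eventually.of_forall (fun t => ?_)
    have := Pz_le hz t
    rwa [Complex.norm_real] at this

/-- The basic inequality for one approximant. -/
lemma one_approx {G H P Y : TT → QC} (hG : C4 A2 G) (hH : C4 A2 H) (hP : C4 LB P) (hP2 : C4 A2 P)
    (hY : C4 A2 Y) (hYG : ∀ᵐ t ∂mT, Y t = G t * P t)
    (hb : ∀ᵐ t ∂mT, H t * ad (H t) = G t * ad (G t)) {z : ℂ} (hz : ‖z‖ < 1) {I : Quaternion ℝ}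
    (hI : I ∈ USphere) :
    ‖dt (PoisQ Y z)‖ * ‖sl I (PoisQ H z)‖ ≤ ‖sl I (PoisQ G z)‖ * ∫ t, Pz z t * ‖dt (Y t)‖ ∂mT := by
  set A := eI I * PoisQ G z with hA
  have hQ : C4 A2 (fun t => P t * star (Y t)) := A2_LB_mul hP hP2 (A2_star hY)
  have hAQ : C4 A2 (fun t => A * (P t * star (Y t))) :=
    A2_LB_mul (C4_const (fun c => memLp_const c) A) (C4_const A2_const A) hQ
  have hA2L : ∀ u, A2 u → L2 u := fun u hu => hu.1
  have e1 : PoisQ (fun t => (A * (P t * star (Y t))) * H t) z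
      = sc (dt (PoisQ Y z)) * (eI I * PoisQ H z) := by
    rw [PoisQ_mul hz hAQ hH, PoisQ_mul hz (C4_const A2_const A) hQ, PoisQ_const hz,
      PoisQ_mul hz hP2 (A2_star hY), PoisQ_star]
    have : PoisQ Y z = PoisQ G z * PoisQ P z := by
      rw [← PoisQ_mul hz hG hP2]; exact PoisQ_congr hYG z
    rw [hA, mul_assoc (eI I), ← mul_assoc (PoisQ G z), ← this, mul_star_eq, ← sc_comm, mul_assoc]
  have hdt : Integrable (fun t => dt (Y t)) mT := by
    have := (L2_mul (hY.imp hA2L) ((A2_star hY).imp hA2L)).1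
    refine this.congr (Eventually.of_forall fun t => ?_)
    simp only [mul_star_eq]; rfl
  have hV : C4 L1 (fun t => (A * (P t * star (Y t))) * H t) := L2_mul (hAQ.imp hA2L) (hH.imp hA2L)
  have hbd := vec_bound hz hV (m := fun t => Real.sqrt (NN A) * ‖dt (Y t)‖)
    (real_int_Pz hz (hdt.norm.const_mul _)) (fun t => by positivity) (by
      filter_upwards [hYG, hb] with t h1 h2
      have hK : (P t * star (Y t) * H t) * ad (P t * star (Y t) * H t) = sc ((‖dt (Y t)‖ ^ 2 : ℝ) : ℂ) := by
        have hQG : P t * star (Y t) * G t = sc (dt (Y t)) := by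
          rw [h1, star_mul, mul_assoc, mul_assoc, star_mul_eq, ← sc_comm, ← mul_assoc, ← sc_comm,
            mul_assoc, mul_star_eq, sc_sc, dt_mul]
        rw [ad_mul, mul_assoc, ← mul_assoc (H t), h2, ← mul_assoc, ← mul_assoc, mul_assoc, ← ad_mul, hQG,
          ad_sc, sc_sc, Complex.mul_conj']
        push_cast; rfl
      rw [mul_assoc, NN_mul_right hK, mul_pow, Real.sq_sqrt (NN_nonneg A), mul_comm])
  rw [e1, NN_sc_mul, eI_mul hI, NN_eI hI] at hbd
  have hNA : NN A = ‖sl I (PoisQ G z)‖ ^ 2 / 2 := by rw [hA, eI_mul hI, NN_eI hI]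
  have e2 : ∫ t, Pz z t * (Real.sqrt (NN A) * ‖dt (Y t)‖) ∂mT
      = Real.sqrt (NN A) * ∫ t, Pz z t * ‖dt (Y t)‖ ∂mT := by
    rw [← integral_const_mul]; congr 1; funext t; ring
  rw [e2, mul_pow, Real.sq_sqrt (NN_nonneg A), hNA] at hbd
  have hM0 : 0 ≤ ∫ t, Pz z t * ‖dt (Y t)‖ ∂mT :=
    integral_nonneg (fun t => mul_nonneg (Pz_nonneg hz t) (norm_nonneg _))
  refine (abs_le_of_sq_le_sq' ?_ (mul_nonneg (norm_nonneg _) hM0)).2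
  rw [mul_pow, mul_pow]
  linarith

lemma int_abs_le {w : TT → ℝ} (h1 : Integrable w mT) (h2 : Integrable (fun t => w t ^ 2) mT) {ε : ℝ}
    (h : ∫ t, w t ^ 2 ∂mT ≤ ε) : ∫ t, w t ∂mT ≤ Real.sqrt ε := by
  apply Real.le_sqrt_of_sq_le
  set m := ∫ t, w t ∂mT
  have h0 : 0 ≤ ∫ t, (w t - m) ^ 2 ∂mT := integral_nonneg (fun t => sq_nonneg _)
  have : ∫ t, (w t - m) ^ 2 ∂mT = ∫ t, w t ^ 2 ∂mT - m ^ 2 := by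
    have : ∀ t, (w t - m) ^ 2 = w t ^ 2 - (2 * m * w t - m ^ 2) := fun t => by ring
    simp only [this]
    have hi : Integrable (fun t => 2 * m * w t - m ^ 2) mT :=
      (h1.const_mul (2 * m)).sub (integrable_const (m ^ 2))
    rw [integral_sub h2 hi,
      integral_sub (h1.const_mul _) (integrable_const _), integral_const_mul]
    simp
    ring
  linarith

lemma Pz_int_le {z : ℂ} (hz : ‖z‖ < 1) {w : TT → ℝ} (h1 : Integrable w mT) (h0 : ∀ t, 0 ≤ w t) :
    ∫ t, Pz z t * w t ∂mT ≤ (∑' n : ℤ, ‖pk z n‖) * ∫ t, w t ∂mT := by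
  rw [← integral_const_mul]
  refine integral_mono (real_int_Pz hz h1) (h1.const_mul _) (fun t => ?_)
  have := Pz_le hz t
  rw [Complex.norm_real, Real.norm_eq_abs] at this
  exact mul_le_mul_of_nonneg_right ((le_abs_self _).trans this) (h0 t)

lemma comp_bound {z : ℂ} (hz : ‖z‖ < 1) {u : TT → ℂ} (hu : L2 u) {c : ℂ} {ε : ℝ}
    (h : ∫ t, ‖u t - c‖ ^ 2 ∂mT ≤ ε) :
    ‖Pois u z - c‖ ≤ (∑' n : ℤ, ‖pk z n‖) * Real.sqrt ε ∧
    (∫ t, Pz z t * (‖u t - c‖ ^ 2) ∂mT ≤ (∑' n : ℤ, ‖pk z n‖) * ε) ∧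
    (∫ t, Pz z t * ‖u t - c‖ ∂mT ≤ (∑' n : ℤ, ‖pk z n‖) * Real.sqrt ε) := by
  have hw : L2 (fun t => u t - c) := hu.sub (memLp_const c)
  have hi := memLp_integrable hw
  have hi2 : Integrable (fun t => ‖u t - c‖ ^ 2) mT := hw.integrable_norm_pow (by norm_num)
  have hC : 0 ≤ ∑' n : ℤ, ‖pk z n‖ := tsum_nonneg (fun _ => norm_nonneg _)
  have h3 : ∫ t, Pz z t * ‖u t - c‖ ∂mT ≤ (∑' n : ℤ, ‖pk z n‖) * Real.sqrt ε :=
    (Pz_int_le hz hi.norm (fun t => norm_nonneg _)).trans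
      (mul_le_mul_of_nonneg_left (int_abs_le hi.norm hi2 h) hC)
  refine ⟨?_, (Pz_int_le hz hi2 (fun t => by positivity)).trans (mul_le_mul_of_nonneg_left h hC), h3⟩
  have e : Pois u z - c = ∫ t, (Pz z t : ℂ) * (u t - c) ∂mT := by
    conv_lhs => rw [← Pois_const hz c]
    unfold Pois
    rw [← integral_sub (integrable_Pz_mul hz (memLp_integrable hu)) (integrable_Pz_mul hz (integrable_const _))]
    congr 1; funext t; ring
  rw [e]
  refine (norm_integral_le_integral_norm _).trans (le_trans (le_of_eq ?_) h3)
  congr 1; funext t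
  rw [norm_mul, Complex.norm_real, Real.norm_eq_abs, abs_of_nonneg (Pz_nonneg hz t)]

lemma sq_bound (y c : ℂ) : ‖y ^ 2 - c ^ 2‖ ≤ ‖y - c‖ ^ 2 + 2 * ‖c‖ * ‖y - c‖ := by
  have : y ^ 2 - c ^ 2 = (y - c) ^ 2 + 2 * c * (y - c) := by ring
  rw [this]
  refine (norm_add_le _ _).trans (le_of_eq ?_)
  simp

lemma dt_up (c : Quaternion ℝ) : dt (up c) = ((‖c‖ ^ 2 : ℝ) : ℂ) := by
  rw [norm_sq_q]; unfold dt up; push_cast; rfl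

lemma dt_sub_le (y : QC) (c : Quaternion ℝ) : ‖dt y‖ ≤ ‖c‖ ^ 2 +
    ((‖y.re - c.re‖ ^ 2 + 2 * ‖c‖ * ‖y.re - c.re‖) + (‖y.imI - c.imI‖ ^ 2 + 2 * ‖c‖ * ‖y.imI - c.imI‖)
    + (‖y.imJ - c.imJ‖ ^ 2 + 2 * ‖c‖ * ‖y.imJ - c.imJ‖)
    + (‖y.imK - c.imK‖ ^ 2 + 2 * ‖c‖ * ‖y.imK - c.imK‖)) := by
  have hc := comp_le c
  have hb : ∀ r : ℝ, r ^ 2 ≤ ‖c‖ ^ 2 → ∀ y : ℂ, ‖y ^ 2 - (r : ℂ) ^ 2‖ ≤ ‖y - r‖ ^ 2 + 2 * ‖c‖ * ‖y - r‖ := by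
    intro r hr y
    have h1 := sq_bound y r
    have h2 : ‖(r : ℂ)‖ ≤ ‖c‖ := by
      rw [Complex.norm_real, Real.norm_eq_abs]
      exact abs_le_of_sq_le_sq hr (norm_nonneg _)
    have h3 : 2 * ‖(r : ℂ)‖ * ‖y - r‖ ≤ 2 * ‖c‖ * ‖y - r‖ := by gcongr
    linarith
  have e : dt y = dt (up c) + ((y.re ^ 2 - (c.re : ℂ) ^ 2) + (y.imI ^ 2 - (c.imI : ℂ) ^ 2) +
      (y.imJ ^ 2 - (c.imJ : ℂ) ^ 2) + (y.imK ^ 2 - (c.imK : ℂ) ^ 2)) := by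
    unfold dt up; simp only [mk4_re, mk4_imI, mk4_imJ, mk4_imK]; ring
  rw [e]
  refine (norm_add_le _ _).trans (add_le_add ?_ ?_)
  · rw [dt_up, Complex.norm_real, Real.norm_eq_abs, abs_of_nonneg (by positivity)]
  · refine (norm_add_le _ _).trans (add_le_add ((norm_add_le _ _).trans (add_le_add
      ((norm_add_le _ _).trans (add_le_add ?_ ?_)) ?_)) ?_)
    · exact hb _ hc.1 _
    · exact hb _ hc.2.1 _
    · exact hb _ hc.2.2.1 _
    · exact hb _ hc.2.2.2 _

lemma M_bound {z : ℂ} (hz : ‖z‖ < 1) {Y : TT → QC} (hY : C4 L2 Y) {c : Quaternion ℝ} {ε : ℝ}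
    (h0 : ∫ t, ‖(Y t).re - c.re‖ ^ 2 ∂mT ≤ ε) (h1 : ∫ t, ‖(Y t).imI - c.imI‖ ^ 2 ∂mT ≤ ε)
    (h2 : ∫ t, ‖(Y t).imJ - c.imJ‖ ^ 2 ∂mT ≤ ε) (h3 : ∫ t, ‖(Y t).imK - c.imK‖ ^ 2 ∂mT ≤ ε) :
    ∫ t, Pz z t * ‖dt (Y t)‖ ∂mT ≤ ‖c‖ ^ 2 + 4 * ((∑' n : ℤ, ‖pk z n‖) * ε
      + 2 * ‖c‖ * ((∑' n : ℤ, ‖pk z n‖) * Real.sqrt ε)) := by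
  have hdt : Integrable (fun t => dt (Y t)) mT := by
    have := (L2_mul hY (C4_star (fun _ h => h.neg) hY)).1
    refine this.congr (Eventually.of_forall fun t => ?_)
    simp only [mul_star_eq]; rfl
  have key : ∀ (u : TT → ℂ) (r : ℝ), L2 u → ∫ t, ‖u t - r‖ ^ 2 ∂mT ≤ ε →
      Integrable (fun t => Pz z t * (‖u t - r‖ ^ 2 + 2 * ‖c‖ * ‖u t - r‖)) mT ∧
      ∫ t, Pz z t * (‖u t - r‖ ^ 2 + 2 * ‖c‖ * ‖u t - r‖) ∂mT ≤ ((∑' n : ℤ, ‖pk z n‖) * ε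
      + 2 * ‖c‖ * ((∑' n : ℤ, ‖pk z n‖) * Real.sqrt ε)) := by
    intro u r hu hr
    have hw : L2 (fun t => u t - r) := hu.sub (memLp_const (r : ℂ))
    have hi := (memLp_integrable hw).norm
    have hi2 : Integrable (fun t => ‖u t - r‖ ^ 2) mT := hw.integrable_norm_pow (by norm_num)
    obtain ⟨-, b, d⟩ := comp_bound hz hu hr
    refine ⟨real_int_Pz hz (hi2.add (hi.const_mul _)), ?_⟩
    have e : ∀ t, Pz z t * (‖u t - r‖ ^ 2 + 2 * ‖c‖ * ‖u t - r‖)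
      = Pz z t * (‖u t - r‖ ^ 2) + 2 * ‖c‖ * (Pz z t * ‖u t - r‖) := fun t => by ring
    simp only [e]
    rw [integral_add (real_int_Pz hz hi2) ((real_int_Pz hz hi).const_mul _), integral_const_mul]
    gcongr
  obtain ⟨i0, k0⟩ := key _ c.re hY.1 h0
  obtain ⟨i1, k1⟩ := key _ c.imI hY.2.1 h1
  obtain ⟨i2, k2⟩ := key _ c.imJ hY.2.2.1 h2
  obtain ⟨i3, k3⟩ := key _ c.imK hY.2.2.2 h3
  have hc1 : Integrable (fun t => Pz z t * ‖c‖ ^ 2) mT := real_int_Pz hz (integrable_const _)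
  have hone : ∫ t, Pz z t * ‖c‖ ^ 2 ∂mT = ‖c‖ ^ 2 := by
    have := Pois_const hz ((‖c‖ ^ 2 : ℝ) : ℂ)
    unfold Pois at this
    have h2 : ∀ t, (Pz z t : ℂ) * ((‖c‖ ^ 2 : ℝ) : ℂ) = ((Pz z t * ‖c‖ ^ 2 : ℝ) : ℂ) := by
      intro t; push_cast; rfl
    simp only [h2] at this
    rw [integral_complex_ofReal] at this
    exact_mod_cast this
  have hle := integral_mono (real_int_Pz hz hdt.norm) (hc1.add (((i0.add i1).add i2).add i3)) (fun t => by
    have := mul_le_mul_of_nonneg_left (dt_sub_le (Y t) c) (Pz_nonneg hz t)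
    simp only [Pi.add_apply]
    refine this.trans (le_of_eq ?_)
    ring)
  refine hle.trans ?_
  rw [integral_add' hc1 (((i0.add i1).add i2).add i3), integral_add' ((i0.add i1).add i2) i3,
    integral_add' (i0.add i1) i2, integral_add' i0 i1, hone]
  linarith

theorem step2 {G H : TT → QC} (hG : C4 A2 G) (hH : C4 A2 H) {c : Quaternion ℝ} (hc : c ≠ 0)
    (happ : ∀ ε : ℝ, 0 < ε → ∃ P Y : TT → QC, C4 LB P ∧ C4 A2 P ∧ C4 A2 Y ∧
      (∀ᵐ t ∂mT, Y t = G t * P t) ∧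
      ∫ t, ‖(Y t).re - c.re‖ ^ 2 ∂mT ≤ ε ∧ ∫ t, ‖(Y t).imI - c.imI‖ ^ 2 ∂mT ≤ ε ∧
      ∫ t, ‖(Y t).imJ - c.imJ‖ ^ 2 ∂mT ≤ ε ∧ ∫ t, ‖(Y t).imK - c.imK‖ ^ 2 ∂mT ≤ ε)
    (hb : ∀ᵐ t ∂mT, H t * ad (H t) = G t * ad (G t)) {z : ℂ} (hz : ‖z‖ < 1) {I : Quaternion ℝ}
    (hI : I ∈ USphere) : ‖sl I (PoisQ H z)‖ ≤ ‖sl I (PoisQ G z)‖ := by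
  have hpos : ∀ n : ℕ, (0 : ℝ) < 1 / ((n : ℝ) + 1) := fun n => by positivity
  choose P Y p1 p2 p3 p4 p5 p6 p7 p8 using fun n : ℕ => happ _ (hpos n)
  have he : Tendsto (fun n : ℕ => (1 : ℝ) / ((n : ℝ) + 1)) atTop (𝓝 0) :=
    tendsto_one_div_add_atTop_nhds_zero_nat
  have hs : Tendsto (fun n : ℕ => Real.sqrt ((1 : ℝ) / ((n : ℝ) + 1))) atTop (𝓝 0) := by
    have := (Real.continuous_sqrt.tendsto 0).comp he
    rwa [Real.sqrt_zero] at this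
  set C := ∑' n : ℤ, ‖pk z n‖
  have hp : ∀ (u : ℕ → TT → ℂ) (r : ℝ), (∀ n, A2 (u n)) →
      (∀ n : ℕ, ∫ t, ‖u n t - r‖ ^ 2 ∂mT ≤ 1 / ((n : ℝ) + 1)) →
      Tendsto (fun n => Pois (u n) z) atTop (𝓝 (r : ℂ)) := by
    intro u r hu hr
    rw [tendsto_iff_norm_sub_tendsto_zero]
    refine squeeze_zero (fun n => norm_nonneg _) (fun n => (comp_bound hz (hu n).1 (hr n)).1) ?_
    simpa using hs.const_mul C
  have t0 := hp (fun n t => (Y n t).re) c.re (fun n => (p3 n).1) p5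
  have t1 := hp (fun n t => (Y n t).imI) c.imI (fun n => (p3 n).2.1) p6
  have t2 := hp (fun n t => (Y n t).imJ) c.imJ (fun n => (p3 n).2.2.1) p7
  have t3 := hp (fun n t => (Y n t).imK) c.imK (fun n => (p3 n).2.2.2) p8
  have hd : Tendsto (fun n => dt (PoisQ (Y n) z)) atTop (𝓝 (dt (up c))) :=
    (((t0.pow 2).add (t1.pow 2)).add (t2.pow 2)).add (t3.pow 2)
  have hdn := hd.norm.mul_const ‖sl I (PoisQ H z)‖
  rw [dt_up, Complex.norm_real, Real.norm_eq_abs, abs_of_nonneg (by positivity)] at hdn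
  have hM : Tendsto (fun n : ℕ => ‖c‖ ^ 2 + 4 * (C * (1 / ((n : ℝ) + 1))
      + 2 * ‖c‖ * (C * Real.sqrt (1 / ((n : ℝ) + 1))))) atTop (𝓝 (‖c‖ ^ 2)) := by
    have := (((he.const_mul C).add ((hs.const_mul C).const_mul (2 * ‖c‖))).const_mul 4).const_add (‖c‖ ^ 2)
    simpa using this
  have hfin := le_of_tendsto_of_tendsto' hdn (hM.const_mul ‖sl I (PoisQ G z)‖) (fun n => by
    refine (one_approx hG hH (p1 n) (p2 n) (p3 n) (p4 n) hb hz hI).trans ?_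
    exact mul_le_mul_of_nonneg_left (M_bound hz ((p3 n).imp fun _ h => h.1) (p5 n) (p6 n) (p7 n) (p8 n))
      (norm_nonneg _))
  have hcp : 0 < ‖c‖ ^ 2 := by positivity
  rw [mul_comm] at hfin
  exact le_of_mul_le_mul_right hfin hcp

end
end OuterProof

namespace OuterProof
open scoped ComplexConjugate
noncomputable section

/-- Two sided square summable quaternionic sequences. -/
abbrev EE : Type := lp (fun _ : ℤ => Quaternion ℝ) 2

/-- Element with given coefficients. -/
def mkE (a : ℤ → Quaternion ℝ) (h : Summable (fun n => ‖a n‖ ^ 2)) : EE :=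
  ⟨a, memℓp_gen (by
    refine h.congr (fun n => ?_)
    simp)⟩

lemma mkE_apply (a : ℤ → Quaternion ℝ) (h : Summable (fun n => ‖a n‖ ^ 2)) (k : ℤ) :
    mkE a h k = a k := rfl

lemma EE_summable (x : EE) : Summable (fun n => ‖x n‖ ^ 2) := by
  have := (lp.memℓp x).summable (by norm_num)
  refine this.congr (fun n => ?_)
  simp

lemma EE_norm (x : EE) : HasSum (fun n => ‖x n‖ ^ 2) (‖x‖ ^ 2) := by
  have := lp.hasSum_inner (𝕜 := ℝ) x x
  rw [real_inner_self_eq_norm_sq] at this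
  exact hsc this (fun i => (real_inner_self_eq_norm_sq _).symm) rfl

lemma sh_summable (x : EE) (n : ℤ) (c : Quaternion ℝ) :
    Summable (fun k => ‖x (k - n) * c‖ ^ 2) := by
  have h1 := ((Equiv.subRight n).summable_iff.mpr (EE_summable x)).mul_right (‖c‖ ^ 2)
  refine h1.congr (fun k => ?_)
  simp [mul_pow]

/-- Shift and right multiplication. -/
def sh (n : ℤ) (c : Quaternion ℝ) (x : EE) : EE := mkE (fun k => x (k - n) * c) (sh_summable x n c)

lemma sh_apply (n : ℤ) (c : Quaternion ℝ) (x : EE) (k : ℤ) : sh n c x k = x (k - n) * c := rfl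

lemma sh_sub (n : ℤ) (c : Quaternion ℝ) (x y : EE) : sh n c (x - y) = sh n c x - sh n c y := by
  ext1; funext k
  simp only [sh_apply, lp.coeFn_sub, Pi.sub_apply, sub_mul]

lemma sh_add (n : ℤ) (c : Quaternion ℝ) (x y : EE) : sh n c (x + y) = sh n c x + sh n c y := by
  ext1; funext k
  simp only [sh_apply, lp.coeFn_add, Pi.add_apply, add_mul]

lemma sh_sh (n m : ℤ) (c d : Quaternion ℝ) (x : EE) : sh n c (sh m d x) = sh (n + m) (d * c) x := by
  ext1; funext k
  simp only [sh_apply, mul_assoc, sub_sub]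

lemma inner_q (a b : Quaternion ℝ) : inner ℝ a b = (star a * b).re := by
  rw [Quaternion.inner_def]; simp

lemma inner_q_mul (a b c : Quaternion ℝ) : inner ℝ (a * c) b = inner ℝ a (b * star c) := by
  rw [Quaternion.inner_def, Quaternion.inner_def]; simp [mul_assoc]

lemma sh_inner (n : ℤ) (c : Quaternion ℝ) (x y : EE) :
    inner ℝ (sh n c x) y = inner ℝ x (sh (-n) (star c) y) := by
  rw [lp.inner_eq_tsum, lp.inner_eq_tsum, ← (Equiv.addRight n).tsum_eq]
  congr 1; funext k
  simp only [sh_apply, Equiv.coe_addRight, inner_q_mul, add_sub_cancel_right, sub_neg_eq_add]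

lemma q_summable (x y : EE) (n : ℤ) : Summable (fun k => star (x k) * y (k + n)) := by
  have h1 := EE_summable x
  have h2 := (Equiv.addRight n).summable_iff.mpr (EE_summable y)
  refine Summable.of_norm_bounded (h1.add h2) (fun k => ?_)
  rw [norm_mul, norm_star]
  simp only [Function.comp, Equiv.coe_addRight]
  nlinarith [sq_nonneg (‖x k‖ - ‖y (k + n)‖), sq_nonneg (‖x k‖), sq_nonneg (‖y (k + n)‖)]

/-- Quaternionic correlation. -/
def Qc (x y : EE) (n : ℤ) : Quaternion ℝ := ∑' k, star (x k) * y (k + n)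

lemma Qc_hasSum (x y : EE) (n : ℤ) : HasSum (fun k => star (x k) * y (k + n)) (Qc x y n) :=
  (q_summable x y n).hasSum

/-- real part as an additive map -/
def reHom : Quaternion ℝ →+ ℝ where
  toFun q := q.re
  map_zero' := Quaternion.re_zero
  map_add' a b := Quaternion.re_add a b

lemma Qc_inner (x y : EE) (n : ℤ) (c : Quaternion ℝ) :
    inner ℝ x (sh (-n) c y) = (Qc x y n * c).re := by
  have h := ((Qc_hasSum x y n).mul_right c).map reHom Quaternion.continuous_re
  rw [lp.inner_eq_tsum]
  refine Eq.trans ?_ h.tsum_eq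
  congr 1; funext k
  simp only [sh_apply, inner_q, sub_neg_eq_add, Function.comp, mul_assoc]
  rfl

lemma Qc_ext {q p : Quaternion ℝ} (h : ∀ c, (q * c).re = (p * c).re) : q = p := by
  have h1 := h (star (q - p))
  have h2 : ((q - p) * star (q - p)).re = 0 := by rw [sub_mul, Quaternion.re_sub, h1, sub_self]
  rw [← Quaternion.inner_def, real_inner_self_eq_norm_sq] at h2
  have h3 : ‖q - p‖ = 0 := by simpa using h2
  exact sub_eq_zero.mp (norm_eq_zero.mp h3)

lemma Qc_star (x y : EE) (n : ℤ) : Qc y x (-n) = star (Qc x y n) := by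
  have h1 := (Equiv.addRight n).hasSum_iff.mpr (Qc_hasSum y x (-n))
  refine h1.unique ?_
  refine hsc (Qc_hasSum x y n).star (fun k => ?_) rfl
  simp

lemma Qc_self (x : EE) : Qc x x 0 = ((‖x‖ ^ 2 : ℝ) : Quaternion ℝ) := by
  have h := (EE_norm x).map (algebraMap ℝ (Quaternion ℝ)) Quaternion.continuous_coe
  refine (hsc h (fun k => ?_) rfl).tsum_eq
  simp only [add_zero, Function.comp]
  rw [Quaternion.star_mul_self, Quaternion.normSq_eq_norm_mul_self, sq]
  rfl

theorem wold (g : EE) (k0 : ℤ) (hk : ∀ k < k0, g k = 0) :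
    ∃ ψ : EE, (∀ k ≤ k0, ψ k = g k) ∧ (∀ n ≠ 0, Qc ψ ψ n = 0) ∧ (∀ n < 0, Qc ψ g n = 0) ∧
      Qc ψ g 0 = Qc ψ ψ 0 ∧
      ∀ ε : ℝ, 0 < ε → ∃ x : EE, (x : ℤ → Quaternion ℝ) ∈ Submodule.span ℝ
        {v : ℤ → Quaternion ℝ | ∃ (n : ℕ) (c : Quaternion ℝ), 1 ≤ n ∧ v = fun k => g (k - n) * c} ∧
        ‖g - x - ψ‖ < ε := by
  set T : Set EE := {x | ∃ (n : ℕ) (c : Quaternion ℝ), 1 ≤ n ∧ x = sh n c g} with hT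
  set N : Submodule ℝ EE := Submodule.span ℝ T with hN
  set M : Submodule ℝ EE := N.topologicalClosure with hM
  have : CompleteSpace M := N.isClosed_topologicalClosure.completeSpace_coe
  obtain ⟨m, hm, ψ, hψ, hsum⟩ := M.exists_add_mem_mem_orthogonal g
  have hNM : N ≤ M := N.le_topologicalClosure
  have hT0 : ∀ (n : ℕ) (c : Quaternion ℝ), 1 ≤ n → inner ℝ ψ (sh n c g) = 0 := fun n c hn =>
    (Submodule.mem_orthogonal' M ψ).mp hψ _ (hNM (Submodule.subset_span ⟨n, c, hn, rfl⟩))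
  have hm0 : ∀ (n : ℕ) (c : Quaternion ℝ), inner ℝ ψ (sh n c m) = 0 := by
    intro n c
    have h1 : sh (-n) (star c) ψ ∈ Nᗮ := by
      rw [Submodule.mem_orthogonal']
      intro u hu
      refine Submodule.span_induction ?_ ?_ ?_ ?_ hu
      · rintro x ⟨j, d, hj, rfl⟩
        rw [sh_inner, sh_sh]
        have := hT0 (n + j) (d * star (star c)) (by omega)
        push_cast at this
        rw [neg_neg]
        exact this
      · exact inner_zero_right _
      · intro x y _ _ hx hy
        rw [inner_add_right, hx, hy, add_zero]
      · intro r x _ hx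
        rw [inner_smul_right, hx, mul_zero]
    rw [← Submodule.orthogonal_closure] at h1
    have h2 := (Submodule.mem_orthogonal' M _).mp h1 m hm
    rw [sh_inner, neg_neg, star_star] at h2
    exact h2
  have hψg : ∀ (n : ℕ) (c : Quaternion ℝ), inner ℝ ψ (sh n c g) = inner ℝ ψ (sh n c ψ) := by
    intro n c
    rw [hsum, sh_add, inner_add_right, hm0, zero_add]
  have hvan : ∀ x ∈ M, ∀ k ≤ k0, x k = 0 := by
    intro x hx k hkk
    have hcl : IsClosed {x : EE | x k = 0} := by
      have hc : Continuous (fun x : EE => x k) :=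
        (continuous_apply k).comp (lp.uniformContinuous_coe (p := 2)).continuous
      exact isClosed_eq hc continuous_const
    refine closure_minimal (s := (N : Set EE)) ?_ hcl hx
    intro u hu
    refine Submodule.span_induction (p := fun (u : EE) _ => u k = 0) ?_ ?_ ?_ ?_ hu
    · rintro x ⟨j, d, hj, rfl⟩
      rw [sh_apply, hk _ (by omega), zero_mul]
    · rfl
    · intro x y _ _ hx hy
      rw [lp.coeFn_add, Pi.add_apply, hx, hy, add_zero]
    · intro r x _ hx
      rw [lp.coeFn_smul, Pi.smul_apply, hx, smul_zero]
  have hneg : ∀ n < 0, Qc ψ ψ n = 0 := by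
    intro n hn
    apply Qc_ext
    intro c
    rw [← Qc_inner, zero_mul, Quaternion.re_zero]
    obtain ⟨j, hj⟩ := Int.eq_ofNat_of_zero_le (show 0 ≤ -n by omega)
    rw [hj, ← hψg]
    exact hT0 j c (by omega)
  refine ⟨ψ, ?_, ?_, ?_, ?_, ?_⟩
  · intro k hkk
    rw [hsum, lp.coeFn_add, Pi.add_apply, hvan m hm k hkk, zero_add]
  · intro n hn
    rcases lt_or_gt_of_ne hn with h | h
    · exact hneg n h
    · have := Qc_star ψ ψ n
      rw [hneg (-n) (by omega)] at this
      exact star_eq_zero.mp this.symm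
  · intro n hn
    apply Qc_ext
    intro c
    rw [← Qc_inner, zero_mul, Quaternion.re_zero]
    obtain ⟨j, hj⟩ := Int.eq_ofNat_of_zero_le (show 0 ≤ -n by omega)
    rw [hj]
    exact hT0 j c (by omega)
  · apply Qc_ext
    intro c
    rw [← Qc_inner, ← Qc_inner]
    exact hψg 0 c
  · intro ε hε
    obtain ⟨x, hx, hd⟩ := Metric.mem_closure_iff.mp (show m ∈ closure (N : Set EE) from hm) ε hε
    refine ⟨x, ?_, ?_⟩
    · refine Submodule.span_induction (p := fun (u : EE) _ => (u : ℤ → Quaternion ℝ) ∈ Submodule.span ℝ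
        {v : ℤ → Quaternion ℝ | ∃ (n : ℕ) (c : Quaternion ℝ), 1 ≤ n ∧ v = fun k => g (k - n) * c})
        ?_ ?_ ?_ ?_ hx
      · rintro x ⟨j, d, hj, rfl⟩
        exact Submodule.subset_span ⟨j, d, hj, rfl⟩
      · exact Submodule.zero_mem _
      · intro x y _ _ hx hy
        exact Submodule.add_mem _ hx hy
      · intro r x _ hx
        exact Submodule.smul_mem _ r hx
    · rw [dist_eq_norm] at hd
      have : g - x - ψ = m - x := by rw [hsum]; abel
      rwa [this]

end
end OuterProof

namespace OuterProof
open scoped ComplexConjugate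
noncomputable section

lemma mk4_ext {a b c d a' b' c' d' : ℂ} (h0 : a = a') (h1 : b = b') (h2 : c = c') (h3 : d = d') :
    mk4 a b c d = mk4 a' b' c' d' := by rw [h0, h1, h2, h3]

lemma fc_four (s : Fin 4 → ℂ) {u0 u1 u2 u3 : TT → ℂ}
    (p0 : L1 u0) (p1 : L1 u1) (p2 : L1 u2) (p3 : L1 u3) (n : ℤ) :
    fourierCoeff (fun t => s 0 * u0 t + s 1 * u1 t + s 2 * u2 t + s 3 * u3 t) n
      = s 0 * fourierCoeff u0 n + s 1 * fourierCoeff u1 n + s 2 * fourierCoeff u2 n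
        + s 3 * fourierCoeff u3 n := by
  have h := fc_lin ![u0, u1, u2, u3] s (by
      intro i; fin_cases i
      · exact p0
      · exact p1
      · exact p2
      · exact p3) n
  simp only [Fin.sum_univ_four] at h
  exact h

lemma fc_add {u v : TT → ℂ} (hu : L1 u) (hv : L1 v) (n : ℤ) :
    fourierCoeff (fun t => u t + v t) n = fourierCoeff u n + fourierCoeff v n := by
  have := fc_four ![1, 1, 0, 0] hu hv hu hu n
  simpa using this

lemma fc_sub {u v : TT → ℂ} (hu : L1 u) (hv : L1 v) (n : ℤ) :
    fourierCoeff (fun t => u t - v t) n = fourierCoeff u n - fourierCoeff v n := by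
  have := fc_four ![1, -1, 0, 0] hu hv hu hu n
  simpa [sub_eq_add_neg] using this

lemma FQ_add {X Y : TT → QC} (hX : C4 L1 X) (hY : C4 L1 Y) (n : ℤ) :
    FQ (fun t => X t + Y t) n = FQ X n + FQ Y n := by
  ext
  · exact (fc_add hX.1 hY.1 n)
  · exact (fc_add hX.2.1 hY.2.1 n)
  · exact (fc_add hX.2.2.1 hY.2.2.1 n)
  · exact (fc_add hX.2.2.2 hY.2.2.2 n)

lemma FQ_sub {X Y : TT → QC} (hX : C4 L1 X) (hY : C4 L1 Y) (n : ℤ) :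
    FQ (fun t => X t - Y t) n = FQ X n - FQ Y n := by
  ext
  · exact (fc_sub hX.1 hY.1 n)
  · exact (fc_sub hX.2.1 hY.2.1 n)
  · exact (fc_sub hX.2.2.1 hY.2.2.1 n)
  · exact (fc_sub hX.2.2.2 hY.2.2.2 n)

lemma fc_mul (c : ℂ) (u : TT → ℂ) (n : ℤ) :
    fourierCoeff (fun t => c * u t) n = c * fourierCoeff u n :=
  fourierCoeff.const_smul u c n

lemma FQ_sc (c : ℂ) (X : TT → QC) (n : ℤ) : FQ (fun t => sc c * X t) n = sc c * FQ X n := by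
  rw [sc_mul]
  unfold FQ
  simp only [sc_mul, mk4_re, mk4_imI, mk4_imJ, mk4_imK, fc_mul]

lemma FQ_shift (j : ℤ) (X : TT → QC) (n : ℤ) :
    FQ (fun t => sc (fourier j t) * X t) n = FQ X (n - j) := by
  unfold FQ
  simp only [sc_mul, mk4_re, mk4_imI, mk4_imJ, mk4_imK, fourierCoeff_fourier_mul]

lemma FQ_star (X : TT → QC) (n : ℤ) : FQ (fun t => star (X t)) n = star (FQ X n) := by
  have hneg : ∀ u : TT → ℂ, fourierCoeff (fun t => - u t) n = - fourierCoeff u n := by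
    intro u
    have := fc_mul (-1) u n
    simpa using this
  unfold FQ
  ext
  · simp
  · simp [hneg]
  · simp [hneg]
  · simp [hneg]

lemma FQ_mul_up {X : TT → QC} (hX : C4 L1 X) (c : Quaternion ℝ) (n : ℤ) :
    FQ (fun t => X t * up c) n = FQ X n * up c := by
  obtain ⟨x0, x1, x2, x3⟩ := hX
  unfold FQ up
  ext
  · have h := fc_four ![(c.re : ℂ), -c.imI, -c.imJ, -c.imK] x0 x1 x2 x3 n
    simp at h
    simp
    refine Eq.trans ?_ (h.trans ?_)
    · congr 1; funext t; ring
    · ring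
  · have h := fc_four ![(c.imI : ℂ), c.re, c.imK, -c.imJ] x0 x1 x2 x3 n
    simp at h
    simp
    refine Eq.trans ?_ (h.trans ?_)
    · congr 1; funext t; ring
    · ring
  · have h := fc_four ![(c.imJ : ℂ), -c.imK, c.re, c.imI] x0 x1 x2 x3 n
    simp at h
    simp
    refine Eq.trans ?_ (h.trans ?_)
    · congr 1; funext t; ring
    · ring
  · have h := fc_four ![(c.imK : ℂ), c.imJ, -c.imI, c.re] x0 x1 x2 x3 n
    simp at h
    simp
    refine Eq.trans ?_ (h.trans ?_)
    · congr 1; funext t; ring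
    · ring

lemma FQ_const (A : QC) {n : ℤ} (hn : n ≠ 0) : FQ (fun _ => A) n = 0 := by
  unfold FQ
  simp only [fc_const _ hn]
  ext
  · rw [mk4_re, Quaternion.re_zero]
  · rw [mk4_imI, Quaternion.imI_zero]
  · rw [mk4_imJ, Quaternion.imJ_zero]
  · rw [mk4_imK, Quaternion.imK_zero]

lemma FQ_const_zero (A : QC) : FQ (fun _ => A) 0 = A := by
  unfold FQ
  have : ∀ c : ℂ, fourierCoeff (fun _ : TT => c) 0 = c := by
    intro c
    unfold fourierCoeff
    simp
  simp only [this]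
  rfl

lemma A2_of {X : TT → QC} (h : C4 L2 X) (h0 : ∀ n < 0, FQ X n = 0) : C4 A2 X := by
  refine ⟨⟨h.1, fun n hn => ?_⟩, ⟨h.2.1, fun n hn => ?_⟩, ⟨h.2.2.1, fun n hn => ?_⟩,
    ⟨h.2.2.2, fun n hn => ?_⟩⟩
  · exact (congrArg (fun Y : QC => Y.re) (h0 n hn)).trans Quaternion.re_zero
  · exact (congrArg (fun Y : QC => Y.imI) (h0 n hn)).trans Quaternion.imI_zero
  · exact (congrArg (fun Y : QC => Y.imJ) (h0 n hn)).trans Quaternion.imJ_zero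
  · exact (congrArg (fun Y : QC => Y.imK) (h0 n hn)).trans Quaternion.imK_zero

lemma A2_to {X : TT → QC} (h : C4 A2 X) {n : ℤ} (hn : n < 0) : FQ X n = 0 := by
  unfold FQ
  rw [h.1.2 n hn, h.2.1.2 n hn, h.2.2.1.2 n hn, h.2.2.2.2 n hn]
  ext
  · rw [mk4_re, Quaternion.re_zero]
  · rw [mk4_imI, Quaternion.imI_zero]
  · rw [mk4_imJ, Quaternion.imJ_zero]
  · rw [mk4_imK, Quaternion.imK_zero]

lemma FQ_ae_zero {X : TT → QC} (hX : C4 L1 X) (h : ∀ n, FQ X n = 0) : ∀ᵐ t ∂mT, X t = 0 := by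
  have a0 := ae_zero_of_fourierCoeff hX.1 (fun n =>
    (congrArg (fun Y : QC => Y.re) (h n)).trans Quaternion.re_zero)
  have a1 := ae_zero_of_fourierCoeff hX.2.1 (fun n =>
    (congrArg (fun Y : QC => Y.imI) (h n)).trans Quaternion.imI_zero)
  have a2 := ae_zero_of_fourierCoeff hX.2.2.1 (fun n =>
    (congrArg (fun Y : QC => Y.imJ) (h n)).trans Quaternion.imJ_zero)
  have a3 := ae_zero_of_fourierCoeff hX.2.2.2 (fun n =>
    (congrArg (fun Y : QC => Y.imK) (h n)).trans Quaternion.imK_zero)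
  filter_upwards [a0, a1, a2, a3] with t h0 h1 h2 h3
  ext
  · rw [h0, Quaternion.re_zero]
  · rw [h1, Quaternion.imI_zero]
  · rw [h2, Quaternion.imJ_zero]
  · rw [h3, Quaternion.imK_zero]

lemma C4_add {P : (TT → ℂ) → Prop} (ha : ∀ u v, P u → P v → P (fun t => u t + v t))
    {X Y : TT → QC} (hX : C4 P X) (hY : C4 P Y) : C4 P (fun t => X t + Y t) :=
  ⟨ha _ _ hX.1 hY.1, ha _ _ hX.2.1 hY.2.1, ha _ _ hX.2.2.1 hY.2.2.1, ha _ _ hX.2.2.2 hY.2.2.2⟩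

lemma C4_sub {P : (TT → ℂ) → Prop} (ha : ∀ u v, P u → P v → P (fun t => u t - v t))
    {X Y : TT → QC} (hX : C4 P X) (hY : C4 P Y) : C4 P (fun t => X t - Y t) :=
  ⟨ha _ _ hX.1 hY.1, ha _ _ hX.2.1 hY.2.1, ha _ _ hX.2.2.1 hY.2.2.1, ha _ _ hX.2.2.2 hY.2.2.2⟩

lemma C4_sc {P : (TT → ℂ) → Prop} {c : ℂ} (ha : ∀ u, P u → P (fun t => c * u t))
    {X : TT → QC} (hX : C4 P X) : C4 P (fun t => sc c * X t) := by
  simp only [sc_mul]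
  exact ⟨ha _ hX.1, ha _ hX.2.1, ha _ hX.2.2.1, ha _ hX.2.2.2⟩

lemma mul_LB {X Y : TT → QC} (hX : C4 L2 X) (hY : C4 LB Y) : C4 L2 (fun t => X t * Y t) :=
  C4_mul (fun _ _ hu hv => hv.mul hu) (fun _ _ hu hv => hu.add hv)
    (fun _ _ hu hv => hu.sub hv) hX hY

lemma LB_L2 {X : TT → QC} (h : C4 LB X) : C4 L2 X := h.imp (fun _ hu => hu.mono_exponent le_top)

/-- correlation of components -/
lemma corr_four (s : Fin 4 → ℂ) {u0 u1 u2 u3 v0 v1 v2 v3 : TT → ℂ}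
    (p0 : L2 u0) (p1 : L2 u1) (p2 : L2 u2) (p3 : L2 u3)
    (q0 : L2 v0) (q1 : L2 v1) (q2 : L2 v2) (q3 : L2 v3) (n : ℤ) :
    HasSum (fun k => s 0 * (conj (fourierCoeff u0 k) * fourierCoeff v0 (k + n))
      + s 1 * (conj (fourierCoeff u1 k) * fourierCoeff v1 (k + n))
      + s 2 * (conj (fourierCoeff u2 k) * fourierCoeff v2 (k + n))
      + s 3 * (conj (fourierCoeff u3 k) * fourierCoeff v3 (k + n)))
    (fourierCoeff (fun t => s 0 * (conj (u0 t) * v0 t) + s 1 * (conj (u1 t) * v1 t)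
      + s 2 * (conj (u2 t) * v2 t) + s 3 * (conj (u3 t) * v3 t)) n) := by
  have hi : ∀ {u v : TT → ℂ}, L2 u → L2 v → L1 (fun t => conj (u t) * v t) :=
    fun hu hv => (memLp_conj hu).integrable_mul hv
  rw [fc_four s (hi p0 q0) (hi p1 q1) (hi p2 q2) (hi p3 q3)]
  exact ((((fourierCoeff_conj_mul p0 q0 n).mul_left _).add ((fourierCoeff_conj_mul p1 q1 n).mul_left _)).add
    ((fourierCoeff_conj_mul p2 q2 n).mul_left _)).add ((fourierCoeff_conj_mul p3 q3 n).mul_left _)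

/-- components as complex valued additive maps -/
def cHom (l : Quaternion ℝ →ₗ[ℝ] ℝ) : Quaternion ℝ →+ ℂ where
  toFun q := (l q : ℂ)
  map_zero' := by simp
  map_add' a b := by simp

lemma FQ_corr {x y : EE} {X Y : TT → QC} (hX : Stem x X) (hY : Stem y Y) (n : ℤ) :
    FQ (fun t => ad (X t) * Y t) n = up (Qc x y n) := by
  obtain ⟨x0, x1, x2, x3⟩ := hX.1
  obtain ⟨y0, y1, y2, y3⟩ := hY.1
  have ex := fun k => FQ_iff (hX.2 k)
  have ey := fun k => FQ_iff (hY.2 (k + n))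
  have hs := Qc_hasSum x y n
  have hre : HasSum (fun k => ((star (x k) * y (k + n)).re : ℂ)) ((Qc x y n).re : ℂ) :=
    Complex.hasSum_ofReal.mpr (hs.map reHom Quaternion.continuous_re)
  have hcm : ∀ (e : Quaternion ℝ),
      HasSum (fun k => ((star (x k) * y (k + n) * e).re : ℂ)) ((Qc x y n * e).re : ℂ) := fun e =>
    Complex.hasSum_ofReal.mpr ((hs.mul_right e).map reHom Quaternion.continuous_re)
  unfold FQ up
  refine mk4_ext ?_ ?_ ?_ ?_
  · have h := corr_four ![1, 1, 1, 1] x0 x1 x2 x3 y0 y1 y2 y3 n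
    simp only [(ex _).1, (ex _).2.1, (ex _).2.2.1, (ex _).2.2.2, (ey _).1, (ey _).2.1, (ey _).2.2.1,
      (ey _).2.2.2] at h
    have e := h.unique (hsc hre (fun k => by simp) rfl)
    refine Eq.trans ?_ e
    congr 1; funext t
    simp [ad, cj]
  · have h := corr_four ![1, -1, -1, 1] x0 x1 x2 x3 y1 y0 y3 y2 n
    simp only [(ex _).1, (ex _).2.1, (ex _).2.2.1, (ex _).2.2.2, (ey _).1, (ey _).2.1, (ey _).2.2.1,
      (ey _).2.2.2] at h
    have e := h.unique (hsc (hcm (mr4 0 (-1) 0 0)) (fun k => by simp) rfl)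
    refine Eq.trans ?_ (e.trans ?_)
    · congr 1; funext t
      simp [ad, cj]
    · simp
  · have h := corr_four ![1, 1, -1, -1] x0 x1 x2 x3 y2 y3 y0 y1 n
    simp only [(ex _).1, (ex _).2.1, (ex _).2.2.1, (ex _).2.2.2, (ey _).1, (ey _).2.1, (ey _).2.2.1,
      (ey _).2.2.2] at h
    have e := h.unique (hsc (hcm (mr4 0 0 (-1) 0)) (fun k => by simp) rfl)
    refine Eq.trans ?_ (e.trans ?_)
    · congr 1; funext t
      simp [ad, cj]
    · simp
  · have h := corr_four ![1, -1, 1, -1] x0 x1 x2 x3 y3 y2 y1 y0 n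
    simp only [(ex _).1, (ex _).2.1, (ex _).2.2.1, (ex _).2.2.2, (ey _).1, (ey _).2.1, (ey _).2.2.1,
      (ey _).2.2.2] at h
    have e := h.unique (hsc (hcm (mr4 0 0 0 (-1))) (fun k => by simp) rfl)
    refine Eq.trans ?_ (e.trans ?_)
    · congr 1; funext t
      simp [ad, cj]
    · simp

lemma comm_inv {X : QC} {s : ℂ} (hs : s ≠ 0) (h : ad X * X = sc s) : X * ad X = sc s := by
  have hd : dt X ≠ 0 := by
    intro h0
    have := congrArg dt h
    rw [dt_mul, h0, mul_zero] at this
    unfold dt sc at this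
    simp at this
    exact hs (pow_eq_zero_iff (two_ne_zero) |>.mp this.symm)
  have h1 : sc (dt X) * ad X = sc s * star X := by
    rw [← h, mul_assoc, mul_star_eq, ← sc_comm]
  have h2 : sc (dt X) * (X * ad X) = sc (dt X) * sc s := by
    rw [sc_comm, mul_assoc, ← sc_comm, h1, ← mul_assoc, ← sc_comm, mul_assoc, mul_star_eq, ← sc_comm]
  have h3 := congrArg (fun q => sc (dt X)⁻¹ * q) h2
  simp only [← mul_assoc, sc_sc, inv_mul_cancel₀ hd] at h3
  have h4 : sc 1 = 1 := one_compC.symm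
  rw [mul_assoc, ] at h3
  simpa only [h4, one_mul] using h3

lemma unit_LB {X : TT → QC} (hX : C4 L2 X) {s : ℝ} (h : ∀ᵐ t ∂mT, X t * ad (X t) = sc s) : C4 LB X := by
  have hb : ∀ᵐ t ∂mT, NN (X t) = s := by
    filter_upwards [h] with t ht
    have := NN_eq (X t)
    rw [ht] at this
    have h2 : (s : ℂ) = NN (X t) := this
    exact_mod_cast h2.symm
  have key : ∀ u : TT → ℂ, L2 u → (∀ t, ‖u t‖ ^ 2 ≤ NN (X t)) → LB u := by
    intro u hu hn
    refine memLp_top_of_bound hu.1 (Real.sqrt s) ?_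
    filter_upwards [hb] with t ht
    apply Real.le_sqrt_of_sq_le
    rw [← ht]; exact hn t
  refine ⟨key _ hX.1 ?_, key _ hX.2.1 ?_, key _ hX.2.2.1 ?_, key _ hX.2.2.2 ?_⟩ <;>
  · intro t
    unfold NN
    nlinarith [sq_nonneg ‖(X t).re‖, sq_nonneg ‖(X t).imI‖, sq_nonneg ‖(X t).imJ‖, sq_nonneg ‖(X t).imK‖]

end
end OuterProof

namespace OuterProof
open scoped ComplexConjugate
noncomputable section

lemma up_add (p q : Quaternion ℝ) : up (p + q) = up p + up q := by
  unfold up; ext <;> simp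

lemma up_sub (p q : Quaternion ℝ) : up (p - q) = up p - up q := by
  unfold up; ext <;> simp

lemma up_zero : up 0 = 0 := by
  have := up_sub 0 0
  simpa using this

lemma up_smul (r : ℝ) (q : Quaternion ℝ) : up (r • q) = sc r * up q := by
  rw [sc_mul]
  unfold up; ext <;> simp

lemma up_coe (r : ℝ) : up (r : Quaternion ℝ) = sc r := by
  unfold up sc; ext <;> simp

lemma gen_LB (n : ℤ) (A : QC) : C4 LB (fun t => sc (fourier n t) * A) := by
  have key : ∀ c : ℂ, LB (fun t => (fourier n t : ℂ) * c) := by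
    intro c
    refine memLp_top_of_bound ?_ ‖c‖ (Eventually.of_forall fun t => ?_)
    · exact ((fourier n).continuous.mul continuous_const).aestronglyMeasurable
    · rw [norm_mul, norm_fourier, one_mul]
  simp only [sc_mul]
  exact ⟨key _, key _, key _, key _⟩

lemma span_stem {g : EE} {G : TT → QC} (hG : Stem g G) {v : ℤ → Quaternion ℝ}
    (hv : v ∈ Submodule.span ℝ
        {v : ℤ → Quaternion ℝ | ∃ (n : ℕ) (c : Quaternion ℝ), 1 ≤ n ∧ v = fun k => g (k - n) * c}) :
    ∃ P : TT → QC, C4 LB P ∧ C4 A2 P ∧ ∀ n, FQ (fun t => G t * P t) n = up (v n) := by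
  refine Submodule.span_induction (p := fun (v : ℤ → Quaternion ℝ) _ => ∃ P : TT → QC, C4 LB P ∧ C4 A2 P ∧
    ∀ n, FQ (fun t => G t * P t) n = up (v n)) ?_ ?_ ?_ ?_ hv
  · rintro v ⟨j, c, hj, rfl⟩
    refine ⟨fun t => sc (fourier j t) * up c, gen_LB _ _, A2_of (LB_L2 (gen_LB _ _)) ?_, ?_⟩
    · intro n hn
      rw [FQ_shift j (fun _ => up c), FQ_const _ (by omega)]
    · intro n
      have : ∀ t, G t * (sc (fourier j t) * up c) = sc (fourier j t) * (G t * up c) := by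
        intro t
        rw [← mul_assoc, ← sc_comm, mul_assoc]
      simp only [this]
      rw [FQ_shift j (fun t => G t * up c), FQ_mul_up (C4_integrable hG.1), hG.2, up_mul]
  · refine ⟨fun _ => up 0, C4_const (fun c => memLp_const c) _, C4_const A2_const _, fun n => ?_⟩
    rw [FQ_mul_up (C4_integrable hG.1), hG.2, ← up_mul, mul_zero]
    rfl
  · rintro x y _ _ ⟨P, p1, p2, p3⟩ ⟨Q, q1, q2, q3⟩
    have hL : C4 L2 (fun t => P t + Q t) :=
      C4_add (fun _ _ hu hv => hu.add hv) (LB_L2 p1) (LB_L2 q1)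
    refine ⟨fun t => P t + Q t, C4_add (fun _ _ hu hv => hu.add hv) p1 q1, A2_of hL ?_, ?_⟩
    · intro n hn
      rw [FQ_add (C4_integrable (LB_L2 p1)) (C4_integrable (LB_L2 q1)), A2_to p2 hn, A2_to q2 hn, add_zero]
    · intro n
      simp only [mul_add]
      rw [FQ_add (L2_mul hG.1 (LB_L2 p1)) (L2_mul hG.1 (LB_L2 q1)), p3, q3, ← up_add]
      rfl
  · rintro r x _ ⟨P, p1, p2, p3⟩
    have hL : C4 LB (fun t => sc r * P t) := C4_sc (fun _ hu => hu.const_mul _) p1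
    refine ⟨fun t => sc r * P t, hL, A2_of (LB_L2 hL) ?_, ?_⟩
    · intro n hn
      rw [FQ_sc, A2_to p2 hn, mul_zero]
    · intro n
      have : ∀ t, G t * (sc r * P t) = sc r * (G t * P t) := by
        intro t
        rw [← mul_assoc, ← sc_comm, mul_assoc]
      simp only [this]
      rw [FQ_sc, p3, ← up_smul]
      rfl

lemma stem_parseval {a : ℤ → Quaternion ℝ} {X : TT → QC} (h : Stem a X) :
    Summable (fun n => ‖a n‖ ^ 2) := by
  have e := fun n => FQ_iff (h.2 n)
  have h4 := (((parseval_norm h.1.1).add (parseval_norm h.1.2.1)).add (parseval_norm h.1.2.2.1)).add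
    (parseval_norm h.1.2.2.2)
  refine h4.summable.congr (fun n => ?_)
  rw [(e n).1, (e n).2.1, (e n).2.2.1, (e n).2.2.2, norm_sq_q]
  simp only [Complex.norm_real, Real.norm_eq_abs, sq_abs]

lemma stem_int {x : EE} {X : TT → QC} (h : Stem x X) :
    ∫ t, ‖(X t).re‖ ^ 2 ∂mT ≤ ‖x‖ ^ 2 ∧ ∫ t, ‖(X t).imI‖ ^ 2 ∂mT ≤ ‖x‖ ^ 2 ∧
    ∫ t, ‖(X t).imJ‖ ^ 2 ∂mT ≤ ‖x‖ ^ 2 ∧ ∫ t, ‖(X t).imK‖ ^ 2 ∂mT ≤ ‖x‖ ^ 2 := by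
  have e := fun n => FQ_iff (h.2 n)
  refine ⟨hasSum_le (fun n => ?_) (parseval_norm h.1.1) (EE_norm x),
    hasSum_le (fun n => ?_) (parseval_norm h.1.2.1) (EE_norm x),
    hasSum_le (fun n => ?_) (parseval_norm h.1.2.2.1) (EE_norm x),
    hasSum_le (fun n => ?_) (parseval_norm h.1.2.2.2) (EE_norm x)⟩
  · rw [(e n).1, Complex.norm_real, Real.norm_eq_abs, sq_abs]; exact (comp_le _).1
  · rw [(e n).2.1, Complex.norm_real, Real.norm_eq_abs, sq_abs]; exact (comp_le _).2.1
  · rw [(e n).2.2.1, Complex.norm_real, Real.norm_eq_abs, sq_abs]; exact (comp_le _).2.2.1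
  · rw [(e n).2.2.2, Complex.norm_real, Real.norm_eq_abs, sq_abs]; exact (comp_le _).2.2.2

lemma stem_star {f : ℕ → Quaternion ℝ} {G : TT → QC} (h : Stem (coefz (conjS f)) G) :
    Stem (coefz f) (fun t => star (G t)) := by
  refine ⟨C4_star (fun _ hu => hu.neg) h.1, fun n => ?_⟩
  rw [FQ_star, h.2, ← up_star]
  unfold coefz conjS
  split_ifs <;> simp

/-- The comparison function obtained from the wandering vector. -/
lemma competitor [IsProbabilityMeasure sphMeasure] {f : ℕ → Quaternion ℝ} (hf : IsOuterQ f)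
    {g ψ : EE} (hg : ∀ k, g k = coefz (conjS f) k) (hψ : ψ ≠ 0)
    (h1 : ∀ n ≠ 0, Qc ψ ψ n = 0) (h2 : ∀ n < 0, Qc ψ g n = 0) (h3 : Qc ψ g 0 = Qc ψ ψ 0) :
    ‖ψ‖ ≤ ‖f 0‖ := by
  have hgf : (g : ℤ → Quaternion ℝ) = coefz (conjS f) := funext hg
  obtain ⟨G, hG⟩ := stem_exists _ (EE_summable g)
  obtain ⟨Ψ, hΨ⟩ := stem_exists _ (EE_summable ψ)
  have hn : 0 < ‖ψ‖ := norm_pos_iff.mpr hψ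
  have hadΨ : C4 L2 (fun t => ad (Ψ t)) := memLp_ad hΨ.1
  have hsq : ∀ᵐ t ∂mT, ad (Ψ t) * Ψ t = sc ((‖ψ‖ ^ 2 : ℝ) : ℂ) := by
    have hc1 : C4 L1 (fun _ : TT => sc ((‖ψ‖ ^ 2 : ℝ) : ℂ)) := C4_const (fun c => integrable_const c) _
    have hz := FQ_ae_zero (X := fun t => ad (Ψ t) * Ψ t - sc ((‖ψ‖ ^ 2 : ℝ) : ℂ))
      (C4_sub (fun _ _ hu hv => hu.sub hv) (L2_mul hadΨ hΨ.1) hc1) (fun n => by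
        rw [FQ_sub (L2_mul hadΨ hΨ.1) hc1, FQ_corr hΨ hΨ]
        by_cases h0 : n = 0
        · rw [h0, FQ_const_zero, Qc_self, up_coe, sub_self]
        · rw [h1 n h0, FQ_const _ h0, up_zero, sub_self])
    filter_upwards [hz] with t ht
    exact sub_eq_zero.mp ht
  have hs0 : ((‖ψ‖ ^ 2 : ℝ) : ℂ) ≠ 0 := by
    exact_mod_cast (pow_pos hn 2).ne'
  have hsq2 : ∀ᵐ t ∂mT, Ψ t * ad (Ψ t) = sc ((‖ψ‖ ^ 2 : ℝ) : ℂ) := by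
    filter_upwards [hsq] with t ht using comm_inv hs0 ht
  have hΨB : C4 LB Ψ := unit_LB hΨ.1 hsq2
  have hK : C4 L2 (fun t => ad (Ψ t) * G t) := LB_mul (memLp_ad hΨB) hG.1
  set r : ℝ := ‖ψ‖⁻¹ with hr
  set h : ℕ → Quaternion ℝ := fun n => r • star (Qc ψ g n) with hh
  set X : TT → QC := fun t => sc r * star (ad (Ψ t) * G t) with hX
  have hSX : Stem (coefz h) X := by
    refine ⟨C4_sc (fun _ hu => hu.const_mul _) (C4_star (fun _ hu => hu.neg) hK), fun n => ?_⟩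
    rw [hX, FQ_sc r (fun t => star (ad (Ψ t) * G t)), FQ_star, FQ_corr hΨ hG, ← up_star, ← up_smul]
    by_cases h0 : 0 ≤ n
    · obtain ⟨m, rfl⟩ := Int.eq_ofNat_of_zero_le h0
      rw [coefz_nat]
    · rw [coefz_neg _ (by omega), h2 n (by omega), star_zero, smul_zero]
  have hmem : MemH2 h := by
    have := stem_parseval hSX
    have h4 := this.comp_injective (Nat.cast_injective (R := ℤ))
    refine h4.congr (fun n => ?_)
    simp only [Function.comp, coefz_nat]
  have hSF : Stem (coefz f) (fun t => star (G t)) := stem_star (by rw [← hgf]; exact hG)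
  have hae : ∀ᵐ q ∂SigmaBd, ‖bdval f q‖ = ‖bdval h q‖ := by
    apply ae_Sigma_of
    filter_upwards [bdval_eq hSX, bdval_eq hSF, hsq2] with t a b c I hI x hx
    rw [a I hI x hx, b I hI x hx]
    refine norm_sl_congr ?_ hI
    have e1 : star (ad (Ψ t) * G t) = star (G t) * cj (Ψ t) := by
      rw [star_mul]; unfold ad; rw [star_star]
    have e2 : ad (cj (Ψ t)) = star (Ψ t) := by unfold ad; rw [cj_cj]
    have e3 : cj (Ψ t) * star (Ψ t) = sc ((‖ψ‖ ^ 2 : ℝ) : ℂ) := by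
      have := congrArg cj c
      rw [cj_mul] at this
      unfold ad at this
      rw [cj_star, cj_cj] at this
      rw [this]
      unfold cj sc
      ext <;> simp
    simp only [hX]
    rw [e1, ad_mul, ad_mul, ad_sc, e2]
    have e4 : sc (r : ℂ) * (star (G t) * cj (Ψ t)) * (star (Ψ t) * ad (star (G t)) * sc (conj (r : ℂ)))
        = sc r * (star (G t) * (cj (Ψ t) * star (Ψ t)) * ad (star (G t))) * sc r := by
      rw [Complex.conj_ofReal]
      simp only [mul_assoc]
    rw [e4, e3, ← sc_comm, ← mul_assoc, sc_sc, ← sc_comm, mul_assoc, ← mul_assoc (sc _) (sc _), sc_sc]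
    have e5 : (r : ℂ) * r * ((‖ψ‖ ^ 2 : ℝ) : ℂ) = 1 := by
      rw [hr]; push_cast
      have : (‖ψ‖ : ℂ) ≠ 0 := by exact_mod_cast hn.ne'
      field_simp
    rw [e5]
    have h4 : sc 1 = 1 := one_compC.symm
    rw [h4, one_mul]
  have hfin := hf.2 h hmem hae 0 (by simp [QBall])
  rw [evalS_zero, evalS_zero, hh] at hfin
  simp only [Nat.cast_zero] at hfin
  rw [h3, Qc_self, norm_smul, norm_star, Quaternion.norm_coe, hr] at hfin
  simp only [norm_inv, norm_norm, Real.norm_eq_abs, abs_pow, abs_norm] at hfin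
  have : ‖ψ‖⁻¹ * ‖ψ‖ ^ 2 = ‖ψ‖ := by field_simp
  rwa [this] at hfin

theorem step1 [IsProbabilityMeasure sphMeasure] {f : ℕ → Quaternion ℝ} (hf : IsOuterQ f)
    (hne : ∃ n, f n ≠ 0) {G : TT → QC} (hG : Stem (coefz (conjS f)) G) :
    f 0 ≠ 0 ∧ ∀ ε : ℝ, 0 < ε → ∃ P Y : TT → QC, C4 LB P ∧ C4 A2 P ∧ C4 A2 Y ∧
      (∀ᵐ t ∂mT, Y t = G t * P t) ∧
      ∫ t, ‖(Y t).re - (conjS f 0).re‖ ^ 2 ∂mT ≤ ε ∧ ∫ t, ‖(Y t).imI - (conjS f 0).imI‖ ^ 2 ∂mT ≤ ε ∧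
      ∫ t, ‖(Y t).imJ - (conjS f 0).imJ‖ ^ 2 ∂mT ≤ ε ∧
      ∫ t, ‖(Y t).imK - (conjS f 0).imK‖ ^ 2 ∂mT ≤ ε := by
  have hsm : Summable (fun n => ‖coefz (conjS f) n‖ ^ 2) := stem_parseval hG
  set g : EE := mkE _ hsm with hgdef
  have hg : ∀ k, g k = coefz (conjS f) k := fun k => rfl
  have hSG : Stem g G := hG
  have hg0 : ∀ k < 0, g k = 0 := fun k hk => coefz_neg _ hk
  set n0 := Nat.find hne
  have hn0 : f n0 ≠ 0 := Nat.find_spec hne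
  have hlow : ∀ k < (n0 : ℤ), g k = 0 := by
    intro k hk
    by_cases h0 : 0 ≤ k
    · obtain ⟨m, rfl⟩ := Int.eq_ofNat_of_zero_le h0
      have := Nat.find_min hne (m := m) (by exact_mod_cast hk)
      rw [hg, coefz_nat]
      unfold conjS
      rw [not_not.mp this, star_zero]
    · exact hg0 k (by omega)
  obtain ⟨ψ, w1, w2, w3, w4, w5⟩ := wold g n0 hlow
  have hψ : ψ ≠ 0 := by
    intro h0
    have := w1 n0 le_rfl
    rw [h0, hg, coefz_nat] at this
    exact hn0 (star_eq_zero.mp this.symm)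
  have hle := competitor hf hg hψ w2 w3 w4
  have hψ0 : ψ 0 = conjS f 0 := by
    rw [w1 0 (by omega), hg]
    exact coefz_nat _ 0
  have hψn : ‖ψ 0‖ = ‖f 0‖ := by rw [hψ0]; exact norm_star _
  have hpos : 0 < ‖ψ‖ := norm_pos_iff.mpr hψ
  have hψk : ∀ k ≠ 0, ψ k = 0 := by
    intro k hk
    have h := sum_le_hasSum {0, k} (fun i _ => sq_nonneg _) (EE_norm ψ)
    rw [Finset.sum_pair hk.symm, hψn] at h
    have h2 : ‖ψ‖ ^ 2 ≤ ‖f 0‖ ^ 2 := pow_le_pow_left₀ (norm_nonneg _) hle 2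
    have h3 : ‖ψ k‖ ^ 2 = 0 := le_antisymm (by linarith) (sq_nonneg _)
    exact norm_eq_zero.mp (pow_eq_zero_iff two_ne_zero |>.mp h3)
  refine ⟨?_, ?_⟩
  · intro h0
    rw [h0, norm_zero] at hle
    linarith
  intro ε hε
  obtain ⟨x, hx, hxn⟩ := w5 (Real.sqrt ε) (Real.sqrt_pos.mpr hε)
  obtain ⟨P, p1, p2, p3⟩ := span_stem hSG hx
  have hone : C4 LB (fun _ : TT => (1 : QC)) := C4_const (fun c => memLp_const c) _
  have hoA : C4 A2 (fun _ : TT => (1 : QC)) := C4_const A2_const _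
  have hPB : C4 LB (fun t => 1 - P t) := C4_sub (fun _ _ hu hv => hu.sub hv) hone p1
  have hY2 : C4 L2 (fun t => G t * (1 - P t)) := mul_LB hG.1 hPB
  have hYF : ∀ n, FQ (fun t => G t * (1 - P t)) n = up (g n - x n) := by
    intro n
    simp only [mul_sub, mul_one]
    rw [FQ_sub (C4_integrable hG.1) (L2_mul hG.1 (LB_L2 p1)), p3, hSG.2, up_sub]
  have hxneg : ∀ n < 0, x n = 0 := by
    intro n hn
    refine Submodule.span_induction (p := fun (v : ℤ → Quaternion ℝ) _ => v n = 0) ?_ ?_ ?_ ?_ hx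
    · rintro v ⟨j, c, hj, rfl⟩
      have e : g (n - (j:ℤ)) = 0 := hg0 _ (by omega)
      exact (congrArg (· * c) e).trans (zero_mul c)
    · rfl
    · intro u v _ _ hu hv
      rw [Pi.add_apply, hu, hv, add_zero]
    · intro r v _ hv
      rw [Pi.smul_apply, hv, smul_zero]
  refine ⟨fun t => 1 - P t, fun t => G t * (1 - P t), hPB, ?_, ?_, Eventually.of_forall fun t => rfl, ?_⟩
  · refine A2_of (LB_L2 hPB) (fun n hn => ?_)
    rw [FQ_sub (C4_integrable (LB_L2 hone)) (C4_integrable (LB_L2 p1)), A2_to p2 hn, A2_to hoA hn, sub_zero]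
  · refine A2_of hY2 (fun n hn => ?_)
    rw [hYF, hg0 n hn, hxneg n hn, sub_zero, up_zero]
  · have hcL : C4 L2 (fun _ : TT => up (conjS f 0)) := C4_const (fun c => memLp_const c) _
    have hst : Stem ((g - x - ψ : EE) : ℤ → Quaternion ℝ) (fun t => G t * (1 - P t) - up (conjS f 0)) := by
      refine ⟨C4_sub (fun _ _ hu hv => hu.sub hv) hY2 hcL, fun n => ?_⟩
      rw [FQ_sub (C4_integrable hY2) (C4_integrable hcL), hYF]
      simp only [lp.coeFn_sub, Pi.sub_apply]
      rw [up_sub (g n - x n)]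
      congr 1
      by_cases h0 : n = 0
      · rw [h0, FQ_const_zero, hψ0]
      · rw [FQ_const _ h0, hψk n h0, up_zero]
    have hb : ‖g - x - ψ‖ ^ 2 ≤ ε := by
      have := pow_le_pow_left₀ (norm_nonneg _) hxn.le 2
      rwa [Real.sq_sqrt hε.le] at this
    obtain ⟨i0, i1, i2, i3⟩ := stem_int hst
    exact ⟨i0.trans hb, i1.trans hb, i2.trans hb, i3.trans hb⟩

lemma conjS_conjS (f : ℕ → Quaternion ℝ) : conjS (conjS f) = f := by
  funext n; unfold conjS; rw [star_star]

lemma conjS_mem {f : ℕ → Quaternion ℝ} (h : MemH2 f) : MemH2 (conjS f) := by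
  refine Summable.congr h (fun n => ?_)
  unfold conjS; rw [norm_star]

lemma ball_phi (q : Quaternion ℝ) (hq : q ∈ QBall) :
    ∃ I ∈ USphere, ∃ z : ℂ, ‖z‖ < 1 ∧ q = phi I z := by
  by_cases h0 : q = 0
  · refine ⟨mr4 0 1 0 0, usph_of rfl (by simp), 0, by simp, ?_⟩
    rw [h0]; unfold phi; simp
  have hn : 0 < ‖q‖ := norm_pos_iff.mpr h0
  obtain ⟨I, hI, h⟩ := exists_unit (‖q‖⁻¹ • q) (by
    rw [norm_smul, norm_inv, norm_norm, inv_mul_cancel₀ hn.ne'])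
  refine ⟨I, hI, (‖q‖ : ℂ) * fourier 1 ((Real.arccos (‖q‖⁻¹ • q).re : ℝ) : TT), ?_, ?_⟩
  · rw [norm_mul, norm_fourier, mul_one, Complex.norm_real, norm_norm]
    exact hq
  · rw [phi_mul hI, ← ptOn_eq, ← h, phi_real, Quaternion.coe_mul_eq_smul, smul_smul,
      mul_inv_cancel₀ hn.ne', one_smul]

theorem outer_conj [IsProbabilityMeasure sphMeasure] {f : ℕ → Quaternion ℝ} (hf : IsOuterQ f) :
    IsOuterQ (conjS f) := by
  by_cases hne : ∃ n, f n ≠ 0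
  swap
  · have : conjS f = f := by
      funext n
      have h0 : f n = 0 := by
        by_contra h; exact hne ⟨n, h⟩
      unfold conjS; rw [h0, star_zero]
    rw [this]; exact hf
  refine ⟨conjS_mem hf.1, fun h hh hae q hq => ?_⟩
  obtain ⟨G, hG⟩ := stem_exists _ (coefz_summable (conjS_mem hf.1))
  obtain ⟨H, hH⟩ := stem_exists _ (coefz_summable hh)
  obtain ⟨hf0, happ⟩ := step1 hf hne hG
  have hb : ∀ᵐ t ∂mT, H t * ad (H t) = G t * ad (G t) := by
    filter_upwards [ae_of_Sigma hae, bdval_eq hG, bdval_eq hH] with t a b c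
    obtain ⟨x, hx, hI⟩ := a
    apply herm_eq
    filter_upwards [hI, ae_usph] with I h1 hu
    rw [b I hu x hx, c I hu x hx] at h1
    exact h1.symm
  obtain ⟨I, hI, z, hz, rfl⟩ := ball_phi q hq
  rw [evalS_eq hG hI hz, evalS_eq hH hI hz]
  exact step2 (stem_A2 hG fun n hn => coefz_neg _ hn) (stem_A2 hH fun n hn => coefz_neg _ hn)
    (c := conjS f 0) (by unfold conjS; exact star_ne_zero.mpr hf0) happ hb hz hI

end
end OuterProof

theorem outer_iff_conj_outer (f : ℕ → Quaternion ℝ) (hf : MemH2 f) :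
    IsOuterQ f ↔ IsOuterQ (conjS f) := by
  rcases OuterProof.sph_cases with h | h
  · exact ⟨fun h1 => absurd h1 (OuterProof.not_outer_of_zero h f),
      fun h1 => absurd h1 (OuterProof.not_outer_of_zero h _)⟩
  · refine ⟨fun h1 => OuterProof.outer_conj h1, fun h1 => ?_⟩
    have := OuterProof.outer_conj h1
    rwa [OuterProof.conjS_conjS] at this
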